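/- If X and Y are nested almost convex sets with |X| = |Y|, then there exists a bijection f : X → Y such that for all pairwise distinct a, b, c ∈ X, orient(a,b,c) > 0 if and only if orient(f(a), f(b), f(c)) > 0. In other words, for each admissible cardinality there is exactly one order type of nested almost convex set. -/

import Mathlib

open Set

noncomputable section

/-- Points of the plane. -/
abbrev Pt : Type := ℝ × ℝ

/-- The orientation determinant of the triple `(a, b, c)`:
`c` lies strictly to the left of the directed line from `a` to `b` iff `orient a b c > 0`. -/
def orient (a b c : Pt) : ℝ :=
  (b.1 - a.1) * (c.2 - a.2) - (b.2 - a.2) * (c.1 - a.1)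

/-- A set of points is in general position if no three pairwise distinct points are collinear. -/
def GenPos (X : Set Pt) : Prop :=
  ∀ a ∈ X, ∀ b ∈ X, ∀ c ∈ X, a ≠ b → a ≠ c → b ≠ c → orient a b c ≠ 0

/-- The set of extreme points of the convex hull of `S`. -/
def extremePts (S : Set Pt) : Set Pt := Set.extremePoints ℝ (convexHull ℝ S)

/-- Remove the extreme points of the convex hull (one peeling step of convex layers). -/
def peel (S : Set Pt) : Set Pt := S \ extremePts S

/-- `X` has exactly `k` convex layers. -/
def HasLayers (X : Set Pt) (k : ℕ) : Prop :=
  peel^[k] X = ∅ ∧ ∀ j < k, peel^[j] X ≠ ∅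

/-- `X_j`, the union of the `j` innermost convex layers (when `X` has `k` layers). -/
def layerSub (X : Set Pt) (k j : ℕ) : Set Pt := peel^[k - j] X

/-- `R_j`, the `j`-th convex layer of `X` (when `X` has `k` layers), `R_1` innermost. -/
def layer (X : Set Pt) (k j : ℕ) : Set Pt := extremePts (layerSub X k j)

/-- `X` is a nested almost convex set. -/
def IsNACS (X : Set Pt) : Prop :=
  X.Finite ∧ X.Nonempty ∧ GenPos X ∧
  ∀ k, HasLayers X k →
    ∀ j, 1 ≤ j → j ≤ k →
      ∀ a ∈ layer X k j, ∀ b ∈ layer X k j, ∀ c ∈ layer X k j,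
        a ≠ b → a ≠ c → b ≠ c →
        ∃! p : Pt, p ∈ layerSub X k (j - 1) ∩ interior (convexHull ℝ ({a, b, c} : Set Pt))

/-- `q` is a counterclockwise enumeration of `S`. -/
def CCWEnum {m : ℕ} (S : Set Pt) (q : Fin m → Pt) : Prop :=
  Function.Injective q ∧ Set.range q = S ∧
  ∀ a b c : Fin m, a < b → b < c → 0 < orient (q a) (q b) (q c)

/-- The ordered pair `(q1, q2)` of points of `R` is adoptable from `p`. -/
def AdoptablePair (R : Set Pt) (p q1 q2 : Pt) : Prop :=
  ∀ q3 ∈ R \ ({q1, q2} : Set Pt), p ∈ interior (convexHull ℝ ({q1, q2, q3} : Set Pt))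

/-- The `i`-th binary string of length `j` in lexicographic order (`false` before `true`). -/
def strOfNat (j i : ℕ) : List Bool :=
  (List.range j).map fun t => i.testBit (j - 1 - t)

/-- The numeric (lexicographic) rank of a binary string among strings of its length. -/
def natOfStr (s : List Bool) : ℕ := s.foldl (fun n b => 2 * n + b.toNat) 0

/-- The leftmost `k`-level descendant of the node `s`. -/
def firstStr (k : ℕ) (s : List Bool) : List Bool := s ++ List.replicate (k - s.length) false

/-- The rightmost `k`-level descendant of the node `s`. -/
def lastStr (k : ℕ) (s : List Bool) : List Bool := s ++ List.replicate (k - s.length) true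

/-- Non-root nodes of the tree `T₁(k)`: binary strings of length `1..k`. -/
def ValidNode1 (k : ℕ) (s : List Bool) : Prop := 1 ≤ s.length ∧ s.length ≤ k

/-- A type-1 labeling of `X`, given by its label function `x` (the inverse of `ψ`). -/
def IsLabeling1 (k : ℕ) (X : Set Pt) (x : List Bool → Pt) : Prop :=
  Set.InjOn x {s | ValidNode1 k s} ∧ x '' {s | ValidNode1 k s} = X

/-- A type-1 labeling is nested. -/
def Nested1 (k : ℕ) (X : Set Pt) (x : List Bool → Pt) : Prop :=
  ∀ j, 1 ≤ j → j ≤ k →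
    CCWEnum (layer X k j) fun i : Fin (2 ^ j) => x (strOfNat j i.val)

/-- A type-1 labeling is adoptable. -/
def Adoptable1 (k : ℕ) (X : Set Pt) (x : List Bool → Pt) : Prop :=
  ∀ s : List Bool, 1 ≤ s.length → s.length + 1 ≤ k →
    AdoptablePair (layer X k (s.length + 1)) (x s) (x (s ++ [false])) (x (s ++ [true]))

/-- `previous[R_k(u)]` for a type-1 labeling: the cyclic predecessor (in the left-to-right,
i.e. counterclockwise, order of the `k`-level) of `first[R_k(u)]`. -/
def prev1 (k : ℕ) (x : List Bool → Pt) (s : List Bool) : Pt :=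
  x (strOfNat k ((natOfStr (firstStr k s) + (2 ^ k - 1)) % 2 ^ k))

/-- `next[R_k(u)]` for a type-1 labeling: the cyclic successor of `last[R_k(u)]`. -/
def next1 (k : ℕ) (x : List Bool → Pt) (s : List Bool) : Pt :=
  x (strOfNat k ((natOfStr (lastStr k s) + 1) % 2 ^ k))

/-- A type-1 labeling is well laid. -/
def WellLaid1 (k : ℕ) (x : List Bool → Pt) : Prop :=
  ∀ s : List Bool, 1 ≤ s.length → s.length ≤ k →
    x s ∈ convexHull ℝ ({prev1 k x s, x (firstStr k s), x (lastStr k s)} : Set Pt) ∧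
    x s ∈ convexHull ℝ ({x (firstStr k s), x (lastStr k s), next1 k x s} : Set Pt)

/-- `X_u` for a type-1 labeling: the labels of the proper descendants of `s`. -/
def descSet1 (k : ℕ) (x : List Bool → Pt) (s : List Bool) : Set Pt :=
  x '' {t | ValidNode1 k t ∧ s <+: t ∧ s ≠ t}

/-- `X̄_u = X_u ∪ {x_u}` for a type-1 labeling. -/
def barSet1 (k : ℕ) (x : List Bool → Pt) (s : List Bool) : Set Pt :=
  insert (x s) (descSet1 k x s)

/-- A type-1 labeling is an internal separation. -/
def InternalSep1 (k : ℕ) (X : Set Pt) (x : List Bool → Pt) : Prop :=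
  ∀ s : List Bool, s.length + 1 ≤ k →
    ∀ y ∈ X \ descSet1 k x s,
      ∀ a ∈ barSet1 k x (s ++ [false]), ∀ b ∈ barSet1 k x (s ++ [true]),
        0 < orient a b y

/-- A type-1 labeling is an external separation. -/
def ExternalSep1 (k : ℕ) (X : Set Pt) (x : List Bool → Pt) : Prop :=
  ∀ s : List Bool, 1 ≤ s.length → s.length + 1 ≤ k →
    ∀ y ∈ X \ barSet1 k x s,
      (∀ a ∈ barSet1 k x (s ++ [false]), 0 < orient a (x s) y) ∧
      (∀ b ∈ barSet1 k x (s ++ [true]), 0 < orient (x s) b y)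

/-- Nodes of the tree `T₂(k)`: the root `none`, and pairs `(c, s)`. -/
abbrev Node2 : Type := Option (Fin 3 × List Bool)

/-- Valid nodes of `T₂(k)`: the root, and pairs `(c, s)` with `|s| ≤ k - 2`. -/
def ValidNode2 (k : ℕ) : Node2 → Prop
  | none => True
  | some (_, s) => s.length + 2 ≤ k

/-- A type-2 labeling of `X`, given by its label function `x` (the inverse of `ψ`). -/
def IsLabeling2 (k : ℕ) (X : Set Pt) (x : Node2 → Pt) : Prop :=
  Set.InjOn x {u | ValidNode2 k u} ∧ x '' {u | ValidNode2 k u} = X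

/-- The `i`-th node (left-to-right) of the `(j+2)`-level of `T₂(k)`. -/
def node2At (j i : ℕ) : Node2 :=
  some (⟨i / 2 ^ j % 3, by omega⟩, strOfNat j (i % 2 ^ j))

/-- A type-2 labeling is nested. -/
def Nested2 (k : ℕ) (X : Set Pt) (x : Node2 → Pt) : Prop :=
  CCWEnum (layer X k 1) (fun _ : Fin 1 => x none) ∧
  ∀ j : ℕ, j + 2 ≤ k →
    CCWEnum (layer X k (j + 2)) fun i : Fin (3 * 2 ^ j) => x (node2At j i.val)

/-- A type-2 labeling is adoptable. -/
def Adoptable2 (k : ℕ) (X : Set Pt) (x : Node2 → Pt) : Prop :=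
  ∀ (c : Fin 3) (s : List Bool), s.length + 3 ≤ k →
    AdoptablePair (layer X k (s.length + 3)) (x (some (c, s)))
      (x (some (c, s ++ [false]))) (x (some (c, s ++ [true])))

/-- `previous[R_k(u)]` for a type-2 labeling, `u = (c, s)`. -/
def prev2 (k : ℕ) (x : Node2 → Pt) (c : Fin 3) (s : List Bool) : Pt :=
  x (node2At (k - 2)
      ((c.val * 2 ^ (k - 2) + natOfStr (firstStr (k - 2) s) + (3 * 2 ^ (k - 2) - 1)) %
        (3 * 2 ^ (k - 2))))

/-- `next[R_k(u)]` for a type-2 labeling, `u = (c, s)`. -/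
def next2 (k : ℕ) (x : Node2 → Pt) (c : Fin 3) (s : List Bool) : Pt :=
  x (node2At (k - 2)
      ((c.val * 2 ^ (k - 2) + natOfStr (lastStr (k - 2) s) + 1) % (3 * 2 ^ (k - 2))))

/-- A type-2 labeling is well laid (the root is the only node with `R_k(u) = R_k`). -/
def WellLaid2 (k : ℕ) (x : Node2 → Pt) : Prop :=
  ∀ (c : Fin 3) (s : List Bool), s.length + 2 ≤ k →
    x (some (c, s)) ∈ convexHull ℝ
      ({prev2 k x c s, x (some (c, firstStr (k - 2) s)),
        x (some (c, lastStr (k - 2) s))} : Set Pt) ∧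
    x (some (c, s)) ∈ convexHull ℝ
      ({x (some (c, firstStr (k - 2) s)), x (some (c, lastStr (k - 2) s)),
        next2 k x c s} : Set Pt)

/-- `X_u` for a type-2 labeling and a non-root node `u = (c, s)`. -/
def descSet2 (k : ℕ) (x : Node2 → Pt) (c : Fin 3) (s : List Bool) : Set Pt :=
  x '' {u | ∃ t : List Bool, u = some (c, t) ∧ t.length + 2 ≤ k ∧ s <+: t ∧ s ≠ t}

/-- `X̄_u = X_u ∪ {x_u}` for a type-2 labeling and a non-root node `u = (c, s)`. -/
def barSet2 (k : ℕ) (x : Node2 → Pt) (c : Fin 3) (s : List Bool) : Set Pt :=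
  insert (x (some (c, s))) (descSet2 k x c s)

/-- A type-2 labeling is an internal separation. -/
def InternalSep2 (k : ℕ) (X : Set Pt) (x : Node2 → Pt) : Prop :=
  (∀ (c : Fin 3) (s : List Bool), s.length + 3 ≤ k →
    ∀ y ∈ X \ descSet2 k x c s,
      ∀ a ∈ barSet2 k x c (s ++ [false]), ∀ b ∈ barSet2 k x c (s ++ [true]),
        0 < orient a b y) ∧
  (∀ i : Fin 3,
    ∀ y ∈ X \ (barSet2 k x i [] ∪ barSet2 k x (i + 1) []),
      ∀ a ∈ barSet2 k x i [], ∀ b ∈ barSet2 k x (i + 1) [],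
        0 < orient a b y)

/-- A type-2 labeling is an external separation. -/
def ExternalSep2 (k : ℕ) (X : Set Pt) (x : Node2 → Pt) : Prop :=
  ∀ (c : Fin 3) (s : List Bool), s.length + 3 ≤ k →
    ∀ y ∈ X \ barSet2 k x c s,
      (∀ a ∈ barSet2 k x c (s ++ [false]), 0 < orient a (x (some (c, s))) y) ∧
      (∀ b ∈ barSet2 k x c (s ++ [true]), 0 < orient (x (some (c, s))) b y)

/-- One corner-refinement step: from `α_s = (q, o, p)` to `α_{s0}` (for `b = false`)
or `α_{s1}` (for `b = true`). -/
def cornerStep (α : Pt × Pt × Pt) (b : Bool) : Pt × Pt × Pt :=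
  let q := α.1
  let o := α.2.1
  let p := α.2.2
  if b then (o + (1 / 5 : ℝ) • (q - o), o + (1 / 5 : ℝ) • (p - o), o + (2 / 5 : ℝ) • (p - o))
  else (o + (2 / 5 : ℝ) • (q - o), o + (1 / 5 : ℝ) • (q - o), o + (1 / 5 : ℝ) • (p - o))

/-- The corner `α_s = (q_s, o_s, p_s)` assigned to the binary string `s` (with parameter `k`). -/
def corner (k : ℕ) (s : List Bool) : Pt × Pt × Pt :=
  s.foldl cornerStep
    (((0 : ℝ), (2 * 5 ^ (k + 1) : ℝ)), ((0 : ℝ), (0 : ℝ)), ((2 * 5 ^ (k + 1) : ℝ), (0 : ℝ)))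

/-- The point `y_v` for a binary string `v = s ++ [b]` of positive length. -/
def ypt (k : ℕ) (v : List Bool) : Pt :=
  let α := corner k v.dropLast
  if v.getLastD false then α.2.1 + (1 / 5 : ℝ) • (α.2.2 - α.2.1)
  else α.2.1 + (1 / 5 : ℝ) • (α.1 - α.2.1)

/-- The point `x_s`: the midpoint of `y_{s·0^(k+1−|s|)}` and `y_{s·1^(k+1−|s|)}`. -/
def xpt (k : ℕ) (s : List Bool) : Pt :=
  (1 / 2 : ℝ) •
    (ypt k (s ++ List.replicate (k + 1 - s.length) false) +
      ypt k (s ++ List.replicate (k + 1 - s.length) true))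



section

lemma ori_rot (a b c : Pt) : orient a b c = orient b c a := by unfold orient; ring
lemma ori_swap (a b c : Pt) : orient a b c = - orient a c b := by unfold orient; ring
lemma ori_swap' (a b c : Pt) : orient a b c = - orient b a c := by unfold orient; ring
lemma ori_aab (a b : Pt) : orient a a b = 0 := by unfold orient; ring
lemma ori_aba (a b : Pt) : orient a b a = 0 := by unfold orient; ring
lemma ori_abb (a b : Pt) : orient a b b = 0 := by unfold orient; ring
lemma ori_split (a b c d : Pt) : orient a b c = orient a b d + orient b c d + orient c a d := by
  unfold orient; ring
/-- Plücker relation. -/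
lemma ori_pl (o u a b c : Pt) :
    orient o u b * orient o a c = orient o u a * orient o b c + orient o u c * orient o a b := by
  unfold orient; ring
lemma ori_bary (a b c u v z : Pt) : orient a b c * orient u v z =
    orient b c z * orient u v a + orient c a z * orient u v b + orient a b z * orient u v c := by
  unfold orient; ring

lemma ori_pos_swap {a b c : Pt} (h : orient a b c ≠ 0) (h' : ¬ 0 < orient a b c) :
    0 < orient a c b := by
  rw [ori_swap]; have := lt_of_le_of_ne (not_lt.1 h') h; linarith

/-- Transitivity in a half plane. -/
lemma ori_trans {o u a b c : Pt} (ha : 0 < orient o u a) (hb : 0 < orient o u b)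
    (hc : 0 < orient o u c) (h1 : 0 < orient o a b) (h2 : 0 < orient o b c) :
    0 < orient o a c := by
  have := ori_pl o u a b c
  have h3 : 0 < orient o u b * orient o a c := by rw [this]; positivity
  exact (mul_pos_iff_of_pos_left hb).1 h3

/-- `z` lies strictly inside the counterclockwise triangle `a b c`. -/
def InTri (a b c z : Pt) : Prop := 0 < orient a b z ∧ 0 < orient b c z ∧ 0 < orient c a z

lemma InTri.pos {a b c z : Pt} (h : InTri a b c z) : 0 < orient a b c := by
  rw [ori_split a b c z]; linarith [h.1, h.2.1, h.2.2]

/-- An affine functional. -/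
def adot (u q y : Pt) : ℝ := u.1 * (y.1 - q.1) + u.2 * (y.2 - q.2)

lemma adot_bary (a b c z u q : Pt) :
    orient a b c * adot u q z =
    orient b c z * adot u q a + orient c a z * adot u q b + orient a b z * adot u q c := by
  unfold orient adot; ring

lemma InTri.not_sep {a b c z u : Pt} (h : InTri a b c z) (ha : 0 < adot u z a)
    (hb : 0 < adot u z b) (hc : 0 < adot u z c) : False := by
  have h1 := adot_bary a b c z u z
  obtain ⟨h2, h3, h4⟩ := h
  have h5 : adot u z z = 0 := by unfold adot; ring
  rw [h5] at h1
  have : 0 < orient b c z * adot u z a + orient c a z * adot u z b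
    + orient a b z * adot u z c := by positivity
  linarith

lemma exists_theta (q u : Pt) : ∃ θ : Pt → ℝ, ∀ y y', 0 < adot u q y → 0 < adot u q y' →
    (0 < orient q y y' ↔ θ y < θ y') := by
  refine ⟨fun y => (u.1 * (y.2 - q.2) - u.2 * (y.1 - q.1)) / adot u q y, ?_⟩
  intro y y' h h'
  have hu : 0 < u.1 ^ 2 + u.2 ^ 2 := by
    by_contra hc
    have h1 : u.1 = 0 := by nlinarith [sq_nonneg u.1, sq_nonneg u.2]
    have h2 : u.2 = 0 := by nlinarith [sq_nonneg u.1, sq_nonneg u.2]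
    simp [adot, h1, h2] at h
  show _ ↔ _ / _ < _ / _
  rw [div_lt_div_iff₀ h h', ← sub_pos (b := _ * _)]
  have : (u.1 * (y'.2 - q.2) - u.2 * (y'.1 - q.1)) * adot u q y -
      (u.1 * (y.2 - q.2) - u.2 * (y.1 - q.1)) * adot u q y' =
      (u.1 ^ 2 + u.2 ^ 2) * orient q y y' := by unfold adot orient; ring
  rw [this]
  exact (mul_pos_iff_of_pos_left hu).symm

/-- Open half plane plus one boundary point is convex. -/
lemma hull_half {S : Set Pt} {u v w : Pt}
    (hS : ∀ y ∈ S, y = w ∨ 0 < orient u v y) (hw : 0 ≤ orient u v w) {z : Pt}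
    (hz : z ∈ convexHull ℝ S) : z = w ∨ 0 < orient u v z := by
  have hc : Convex ℝ {y : Pt | y = w ∨ 0 < orient u v y} := by
    intro x hx y hy a b ha hb hab
    have key : orient u v (a • x + b • y) = a * orient u v x + b * orient u v y := by
      have : b = 1 - a := by linarith
      subst this
      simp [orient]; ring
    have hx' : 0 ≤ orient u v x := by rcases hx with rfl | h; exacts [hw, h.le]
    have hy' : 0 ≤ orient u v y := by rcases hy with rfl | h; exacts [hw, h.le]
    rcases ha.eq_or_lt with rfl | ha
    · have : b = 1 := by linarith
      subst this; simpa using hy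
    rcases hb.eq_or_lt with rfl | hb
    · have : a = 1 := by linarith
      subst this; simpa using hx
    rcases hx with rfl | hx
    · rcases hy with rfl | hy
      · left; rw [← add_smul, hab, one_smul]
      · right; rw [key]; positivity
    · right; rw [key]; positivity
  exact convexHull_min (fun y hy => hS y hy) hc hz

lemma hull_nonneg {S : Set Pt} {u v : Pt}
    (hS : ∀ y ∈ S, 0 ≤ orient u v y) {z : Pt}
    (hz : z ∈ convexHull ℝ S) : 0 ≤ orient u v z := by
  have hc : Convex ℝ {y : Pt | 0 ≤ orient u v y} := by
    intro x hx y hy a b ha hb hab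
    have key : orient u v (a • x + b • y) = a * orient u v x + b * orient u v y := by
      have : b = 1 - a := by linarith
      subst this
      simp [orient]; ring
    have hx' : 0 ≤ orient u v x := hx
    have hy' : 0 ≤ orient u v y := hy
    show 0 ≤ orient u v _
    rw [key]; positivity
  exact convexHull_min (fun y hy => hS y hy) hc hz

lemma InTri.mem_hull {a b c z : Pt} (h : InTri a b c z) : z ∈ convexHull ℝ ({a, b, c} : Set Pt) := by
  have hp := h.pos
  obtain ⟨h1, h2, h3⟩ := h
  have hs := ori_split a b c z
  rw [convexHull_insert (by simp)]
  simp only [convexHull_pair, mem_convexJoin, mem_singleton_iff, exists_eq_left]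
  have hbc : 0 < orient c a z + orient a b z := by linarith
  set w := (orient c a z / (orient c a z + orient a b z)) • b +
    (orient a b z / (orient c a z + orient a b z)) • c with hw
  refine ⟨w, ⟨_, _, by positivity, by positivity, by field_simp, hw.symm⟩, ?_⟩
  refine ⟨orient b c z / orient a b c, (orient c a z + orient a b z) / orient a b c,
    by positivity, by positivity, by rw [hs]; field_simp; ring, ?_⟩
  have e : ((orient c a z + orient a b z) / orient a b c) • w =
      (orient c a z / orient a b c) • b + (orient a b z / orient a b c) • c := by
    rw [hw, smul_add, smul_smul, smul_smul]
    congr 2 <;> field_simp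
  rw [e]
  ext
  · simp only [Prod.fst_add, Prod.smul_fst, smul_eq_mul]
    field_simp
    unfold orient; ring
  · simp only [Prod.snd_add, Prod.smul_snd, smul_eq_mul]
    field_simp
    unfold orient; ring

lemma continuous_orient (a b : Pt) : Continuous (fun z => orient a b z) := by
  unfold orient; fun_prop

lemma InTri.mem_interior {a b c z : Pt} (h : InTri a b c z) :
    z ∈ interior (convexHull ℝ ({a, b, c} : Set Pt)) := by
  have ho : IsOpen {z | InTri a b c z} := by
    have h1 : IsOpen {z | 0 < orient a b z} := isOpen_lt continuous_const (continuous_orient a b)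
    have h2 : IsOpen {z | 0 < orient b c z} := isOpen_lt continuous_const (continuous_orient b c)
    have h3 : IsOpen {z | 0 < orient c a z} := isOpen_lt continuous_const (continuous_orient c a)
    exact h1.inter (h2.inter h3)
  exact interior_maximal (fun y hy => InTri.mem_hull hy) ho h

lemma nonneg_of_mem_hull {a b c z : Pt} (h : 0 < orient a b c)
    (hz : z ∈ convexHull ℝ ({a, b, c} : Set Pt)) : 0 ≤ orient a b z := by
  refine hull_nonneg ?_ hz
  rintro y (rfl | rfl | rfl)
  · rw [ori_aba]
  · rw [ori_abb]
  · exact h.le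

end

section

/-- The basic configuration: outer layer `R`, inner points `Z`. -/
structure Cfg (Z R : Finset Pt) : Prop where
  disj : ∀ z ∈ Z, z ∉ R
  gp : ∀ a b c, (a ∈ Z ∨ a ∈ R) → (b ∈ Z ∨ b ∈ R) → (c ∈ Z ∨ c ∈ R) →
    a ≠ b → a ≠ c → b ≠ c → orient a b c ≠ 0
  sep : ∀ r ∈ R, ∃ u : Pt, ∀ y, (y ∈ Z ∨ y ∈ R) → y ≠ r → 0 < adot u r y
  hull : ∀ z ∈ Z, z ∈ convexHull ℝ (R : Set Pt)
  ex : ∀ a ∈ R, ∀ b ∈ R, ∀ c ∈ R, 0 < orient a b c → ∃ z ∈ Z, InTri a b c z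
  un : ∀ a ∈ R, ∀ b ∈ R, ∀ c ∈ R, ∀ z ∈ Z, ∀ w ∈ Z, InTri a b c z → InTri a b c w → z = w

namespace Cfg

variable {Z R : Finset Pt}

lemma neZR (h : Cfg Z R) {z r : Pt} (hz : z ∈ Z) (hr : r ∈ R) : z ≠ r := by
  rintro rfl; exact h.disj _ hz hr

/-- Points of `R` are not inside triangles. -/
lemma notTri (h : Cfg Z R) {r a b c : Pt} (hr : r ∈ R) (ha : a ∈ Z ∨ a ∈ R) (hb : b ∈ Z ∨ b ∈ R)
    (hc : c ∈ Z ∨ c ∈ R) (ht : InTri a b c r) : False := by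
  obtain ⟨u, hu⟩ := h.sep r hr
  refine ht.not_sep (hu a ha ?_) (hu b hb ?_) (hu c hc ?_)
  · rintro rfl; have := ht.1; rw [ori_aba] at this; exact lt_irrefl _ this
  · rintro rfl; have := ht.1; rw [ori_abb] at this; exact lt_irrefl _ this
  · rintro rfl; have := ht.2.1; rw [ori_abb] at this; exact lt_irrefl _ this

open Classical in
lemma lower (h : Cfg Z R) {S : Finset Pt} (hS : S ⊆ R) :
    S.card ≤ (Z.filter fun z => ∃ a ∈ S, ∃ b ∈ S, ∃ c ∈ S, InTri a b c z).card + 2 := by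
  rcases S.eq_empty_or_nonempty with rfl | ⟨q, hq⟩
  · simp
  obtain ⟨u, hu⟩ := h.sep q (hS hq)
  obtain ⟨θ, hθ⟩ := exists_theta q u
  have key : ∀ S' : Finset Pt, S' ⊆ S.erase q → ∃ T : Finset Pt, T ⊆ Z ∧ S'.card ≤ T.card + 1 ∧
      ∀ t ∈ T, (∃ a ∈ S, ∃ b ∈ S, ∃ c ∈ S, InTri a b c t) ∧ ∃ s ∈ S', θ t < θ s := by
    intro S'
    induction S' using Finset.induction_on_max_value θ with
    | empty => intro _; exact ⟨∅, by simp⟩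
    | insert a s ha hmax ih =>
      intro hsub
      have hsub' : s ⊆ S.erase q := (Finset.subset_insert _ _).trans hsub
      have haS := Finset.mem_erase.1 (hsub (Finset.mem_insert_self _ _))
      obtain ⟨T, hTZ, hTc, hT⟩ := ih hsub'
      rcases s.eq_empty_or_nonempty with rfl | hne
      · exact ⟨∅, by simp⟩
      obtain ⟨m, hm, hmm⟩ := s.exists_max_image θ hne
      have hmS := Finset.mem_erase.1 (hsub' hm)
      have hma : m ≠ a := by rintro rfl; exact ha hm
      have hpm := hu m (Or.inr (hS hmS.2)) hmS.1
      have hpa := hu a (Or.inr (hS haS.2)) haS.1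
      have ho : 0 < orient q m a := by
        have hne := h.gp q a m (Or.inr (hS hq)) (Or.inr (hS haS.2)) (Or.inr (hS hmS.2))
          haS.1.symm hmS.1.symm hma.symm
        refine ori_pos_swap hne fun hc => ?_
        have := (hθ a m hpa hpm).1 hc
        linarith [hmax m hm]
      obtain ⟨z, hz, hzt⟩ := h.ex q (hS hq) m (hS hmS.2) a (hS haS.2) ho
      have hpz := hu z (Or.inl hz) (h.neZR hz (hS hq))
      have h1 : θ m < θ z := (hθ _ _ hpm hpz).1 hzt.1
      have h2 : θ z < θ a := (hθ _ _ hpz hpa).1 (by rw [← ori_rot]; exact hzt.2.2)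
      have hzT : z ∉ T := by
        intro hzT
        obtain ⟨_, s', hs', hlt⟩ := hT z hzT
        linarith [hmm s' hs']
      refine ⟨insert z T, ?_, ?_, ?_⟩
      · intro w hw
        rcases Finset.mem_insert.1 hw with rfl | hw
        exacts [hz, hTZ hw]
      · rw [Finset.card_insert_of_notMem hzT, Finset.card_insert_of_notMem ha]; omega
      · intro t ht
        rcases Finset.mem_insert.1 ht with rfl | ht
        · exact ⟨⟨q, hq, m, hmS.2, a, haS.2, hzt⟩, a, Finset.mem_insert_self _ _, h2⟩
        · obtain ⟨h3, s', hs', hlt⟩ := hT t ht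
          exact ⟨h3, s', Finset.mem_insert_of_mem hs', hlt⟩
  obtain ⟨T, hTZ, hTc, hT⟩ := key _ subset_rfl
  have h1 : T.card ≤ (Z.filter fun z => ∃ a ∈ S, ∃ b ∈ S, ∃ c ∈ S, InTri a b c z).card :=
    Finset.card_le_card fun t ht => Finset.mem_filter.2 ⟨hTZ ht, (hT t ht).1⟩
  have := Finset.card_erase_of_mem hq
  have := Finset.card_pos.2 ⟨q, hq⟩
  omega

lemma exists_below (h : Cfg Z R) {q z : Pt} (hq : q ∈ R) (hz : z ∈ Z) :
    ∃ r ∈ R, r ≠ q ∧ 0 < orient q r z := by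
  by_contra hc
  push Not at hc
  have := hull_half (S := (R : Set Pt)) (u := q) (v := z) (w := q) (z := z) ?_
    (by rw [ori_aba]) (h.hull z hz)
  · rcases this with h1 | h1
    · exact h.neZR hz hq h1
    · rw [ori_abb] at h1; exact lt_irrefl _ h1
  · intro y hy
    by_cases hyq : y = q
    · exact Or.inl hyq
    · right
      exact ori_pos_swap (h.gp q y z (Or.inr hq) (Or.inr hy) (Or.inl hz) (Ne.symm hyq)
        (h.neZR hz hq).symm (h.neZR hz hy).symm) (not_lt.2 (hc y hy hyq))

lemma exists_above (h : Cfg Z R) {q z : Pt} (hq : q ∈ R) (hz : z ∈ Z) :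
    ∃ r ∈ R, r ≠ q ∧ 0 < orient q z r := by
  by_contra hc
  push Not at hc
  have := hull_half (S := (R : Set Pt)) (u := z) (v := q) (w := q) (z := z) ?_
    (by rw [ori_abb]) (h.hull z hz)
  · rcases this with h1 | h1
    · exact h.neZR hz hq h1
    · rw [ori_aba] at h1; exact lt_irrefl _ h1
  · intro y hy
    by_cases hyq : y = q
    · exact Or.inl hyq
    · right
      rw [ori_rot]
      exact ori_pos_swap (h.gp q z y (Or.inr hq) (Or.inl hz) (Or.inr hy)
        (h.neZR hz hq).symm (Ne.symm hyq) (h.neZR hz hy)) (not_lt.2 (hc y hy hyq))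

lemma upper (h : Cfg Z R) (hZ : Z.Nonempty) : Z.card + 2 ≤ R.card := by
  classical
  obtain ⟨z0, hz0⟩ := hZ
  obtain ⟨q, hq⟩ : R.Nonempty := by
    by_contra hc
    rw [Finset.not_nonempty_iff_eq_empty] at hc
    have := h.hull z0 hz0
    rw [hc] at this; simp at this
  obtain ⟨u, hu⟩ := h.sep q hq
  obtain ⟨θ, hθ⟩ := exists_theta q u
  have hdz : ∀ z ∈ Z, 0 < adot u q z := fun z hz => hu z (Or.inl hz) (h.neZR hz hq)
  have hdr : ∀ r ∈ R, r ≠ q → 0 < adot u q r := fun r hr hrq => hu r (Or.inr hr) hrq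
  -- the next vertex above z
  have hnext : ∀ z ∈ Z, ∃ m ∈ R, m ≠ q ∧ θ z < θ m ∧ ∀ r ∈ R, r ≠ q → θ z < θ r → θ m ≤ θ r := by
    intro z hz
    obtain ⟨r, hr, hrq, hro⟩ := h.exists_above hq hz
    obtain ⟨m, hm, hmin⟩ := (R.filter fun r => r ≠ q ∧ θ z < θ r).exists_min_image θ
      ⟨r, by
        simp only [Finset.mem_filter]
        exact ⟨hr, hrq, (hθ _ _ (hdz z hz) (hdr r hr hrq)).1 hro⟩⟩
    simp only [Finset.mem_filter] at hm hmin
    exact ⟨m, hm.1, hm.2.1, hm.2.2, fun r hr h1 h2 => hmin r ⟨hr, h1, h2⟩⟩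
  choose! nx hnR hnq hnlt hnmin using hnext
  have hinj : ∀ z ∈ Z, ∀ w ∈ Z, nx z = nx w → z = w := by
    intro z hz w hw hzw
    set m := nx z with hmdef
    have hmR : m ∈ R := hnR z hz
    have hmq : m ≠ q := hnq z hz
    -- the vertex below
    obtain ⟨r, hr, hrq, hro⟩ := h.exists_below hq hz
    obtain ⟨m', hm', hmax⟩ := (R.filter fun r => r ≠ q ∧ θ r < θ z).exists_max_image θ
      ⟨r, by
        simp only [Finset.mem_filter]
        exact ⟨hr, hrq, (hθ _ _ (hdr r hr hrq) (hdz z hz)).1 hro⟩⟩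
    simp only [Finset.mem_filter] at hm' hmax
    obtain ⟨hm'R, hm'q, hm'lt⟩ := hm'
    have hzne : ∀ z ∈ Z, ∀ r ∈ R, r ≠ q → θ r ≠ θ z := by
      intro z hz r hr hrq he
      have h1 := h.gp q r z (Or.inr hq) (Or.inr hr) (Or.inl hz) hrq.symm (h.neZR hz hq).symm
        (h.neZR hz hr).symm
      rcases lt_or_gt_of_ne h1 with h2 | h2
      · have : 0 < orient q z r := by rw [ori_swap]; linarith
        exact absurd ((hθ _ _ (hdz z hz) (hdr r hr hrq)).1 this) (by rw [he]; exact lt_irrefl _)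
      · exact absurd ((hθ _ _ (hdr r hr hrq) (hdz z hz)).1 h2) (by rw [he]; exact lt_irrefl _)
    have hm'w : θ m' < θ w := by
      by_contra hc
      have h1 : θ w < θ m' := lt_of_le_of_ne (not_lt.1 hc) (hzne w hw m' hm'R hm'q).symm
      have h2 := hnmin w hw m' hm'R hm'q h1
      rw [← hzw] at h2
      linarith [hnlt z hz]
    have hmm' : θ m' < θ m := hm'lt.trans (hnlt z hz)
    have hne : m' ≠ m := by rintro h1; rw [h1] at hmm'; exact lt_irrefl _ hmm'
    have ho : 0 < orient q m' m := (hθ _ _ (hdr _ hm'R hm'q) (hdr _ hmR hmq)).2 hmm'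
    have hcons : ∀ y ∈ R, y ≠ q → y ≠ m → y ≠ m' → θ y < θ m' ∨ θ m < θ y := by
      intro y hy hyq hym hym'
      have hth : ∀ x ∈ R, x ≠ q → y ≠ x → θ y ≠ θ x := by
        intro x hx hxq hyx he
        have h1 := h.gp q y x (Or.inr hq) (Or.inr hy) (Or.inr hx) hyq.symm hxq.symm hyx
        rcases lt_or_gt_of_ne h1 with h2 | h2
        · have : 0 < orient q x y := by rw [ori_swap]; linarith
          exact absurd ((hθ _ _ (hdr x hx hxq) (hdr y hy hyq)).1 this)
            (by rw [he]; exact lt_irrefl _)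
        · exact absurd ((hθ _ _ (hdr y hy hyq) (hdr x hx hxq)).1 h2)
            (by rw [he]; exact lt_irrefl _)
      rcases lt_or_gt_of_ne (hzne z hz y hy hyq) with h1 | h1
      · left
        exact lt_of_le_of_ne (hmax y ⟨hy, hyq, h1⟩) (hth m' hm'R hm'q hym')
      · right
        exact lt_of_le_of_ne (hnmin z hz y hy hyq h1) (hth m hmR hmq hym).symm
    have hedge : ∀ y ∈ R, 0 ≤ orient m' m y := by
      intro y hy
      by_cases hyq : y = q
      · subst hyq; rw [← ori_rot]; exact ho.le
      by_cases hym : y = m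
      · subst hym; rw [ori_abb]
      by_cases hym' : y = m'
      · subst hym'; rw [ori_aba]
      by_contra hc
      push Not at hc
      rcases hcons y hy hyq hym hym' with h1 | h1
      · have h2 := (hθ _ _ (hdr y hy hyq) (hdr _ hm'R hm'q)).2 h1
        refine h.notTri hm'R (Or.inr hq) (Or.inr hy) (Or.inr hmR) ⟨h2, ?_, ?_⟩
        · have := ori_rot y m m'
          have := ori_rot m m' y
          have := ori_swap' m m' y
          linarith
        · have := ori_rot m q m'
          linarith
      · have h2 := (hθ _ _ (hdr _ hmR hmq) (hdr y hy hyq)).2 h1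
        refine h.notTri hmR (Or.inr hq) (Or.inr hm'R) (Or.inr hy) ⟨ho, ?_, ?_⟩
        · have := ori_swap m' y m
          linarith
        · have := ori_rot y q m
          linarith
    have hin : ∀ z ∈ Z, θ m' < θ z → θ z < θ m → InTri q m' m z := by
      intro z hz h1 h2
      refine ⟨(hθ _ _ (hdr _ hm'R hm'q) (hdz z hz)).2 h1, ?_, ?_⟩
      · exact lt_of_le_of_ne (hull_nonneg (S := (R : Set Pt)) (fun y hy => hedge y hy) (h.hull z hz))
          (h.gp _ _ _ (Or.inr hm'R) (Or.inr hmR) (Or.inl hz) hne (h.neZR hz hm'R).symm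
            (h.neZR hz hmR).symm).symm
      · rw [ori_rot]; exact (hθ _ _ (hdz z hz) (hdr _ hmR hmq)).2 h2
    exact h.un q hq m' hm'R m hmR z hz w hw (hin z hz hm'lt (hnlt z hz))
      (hin w hw hm'w (by have := hnlt w hw; rwa [← hzw] at this))
  -- the minimal vertex
  obtain ⟨r0, hr0, hr0q, _⟩ := h.exists_below hq hz0
  obtain ⟨m0, hm0, hmin0⟩ := (R.erase q).exists_min_image θ ⟨r0, Finset.mem_erase.2 ⟨hr0q, hr0⟩⟩
  have hle : Z.card ≤ ((R.erase q).erase m0).card := by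
    refine Finset.card_le_card_of_injOn nx ?_ (fun z hz w hw => hinj z hz w hw)
    intro z hz
    obtain ⟨r, hr, hrq, hro⟩ := h.exists_below hq hz
    have h1 := (hθ _ _ (hdr r hr hrq) (hdz z hz)).1 hro
    have h2 := hmin0 r (Finset.mem_erase.2 ⟨hrq, hr⟩)
    have h3 := hnlt z hz
    refine Finset.mem_coe.2 (Finset.mem_erase.2 ⟨?_, Finset.mem_erase.2 ⟨hnq z hz, hnR z hz⟩⟩)
    intro he; rw [he] at h3; linarith
  rw [Finset.card_erase_of_mem hm0, Finset.card_erase_of_mem hq] at hle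
  have h1 := Finset.card_pos.2 ⟨m0, hm0⟩
  rw [Finset.card_erase_of_mem hq] at h1
  omega

lemma card_eq (h : Cfg Z R) (hZ : Z.Nonempty) : R.card = Z.card + 2 := by
  classical
  refine le_antisymm ?_ (h.upper hZ)
  refine (h.lower subset_rfl).trans ?_
  have := Finset.card_filter_le Z (fun z => ∃ a ∈ R, ∃ b ∈ R, ∃ c ∈ R, InTri a b c z)
  omega

/-- Counting in an open half plane bounded by the line `u v`,
with `S` allowed to contain at most one point on the line. -/
lemma half (h : Cfg Z R) {S : Finset Pt} (hS : S ⊆ R) {u v w : Pt}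
    (hs : ∀ s ∈ S, s = w ∨ 0 < orient u v s) (hw : 0 ≤ orient u v w) :
    S.card ≤ (Z.filter fun z => 0 < orient u v z).card + 2 := by
  classical
  refine (h.lower hS).trans (Nat.add_le_add_right (Finset.card_le_card ?_) 2)
  intro z hz
  simp only [Finset.mem_filter] at hz ⊢
  refine ⟨hz.1, ?_⟩
  obtain ⟨a, ha, b, hb, c, hc, ht⟩ := hz.2
  have := hull_half (S := ({a, b, c} : Set Pt)) (u := u) (v := v) (w := w) (z := z) ?_ hw ht.mem_hull
  · rcases this with rfl | h1
    · have hb' : ∀ x ∈ S, x ≠ z := fun x hx => (h.neZR hz.1 (hS hx)).symm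
      have h1 := (hs a ha).resolve_left (hb' a ha)
      have h2 := (hs b hb).resolve_left (hb' b hb)
      have h3 := (hs c hc).resolve_left (hb' c hc)
      have h4 := ori_bary a b c u v z
      have h5 := ht.pos
      obtain ⟨h6, h7, h8⟩ := ht
      refine (mul_pos_iff_of_pos_left h5).1 ?_
      rw [h4]; positivity
    · exact h1
  · rintro y (rfl | rfl | rfl)
    exacts [hs _ ha, hs _ hb, hs _ hc]

lemma card_split (A : Finset Pt) (u v : Pt) (hA : ∀ a ∈ A, orient u v a ≠ 0) :
    (A.filter fun a => 0 < orient u v a).card + (A.filter fun a => 0 < orient v u a).card = A.card := by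
  classical
  rw [← Finset.card_union_of_disjoint]
  · congr 1
    ext a
    simp only [Finset.mem_union, Finset.mem_filter]
    constructor
    · rintro (h | h) <;> exact h.1
    · intro ha
      rcases lt_or_gt_of_ne (hA a ha) with h1 | h1
      · right; refine ⟨ha, ?_⟩; rw [ori_swap']; linarith
      · exact Or.inl ⟨ha, h1⟩
  · rw [Finset.disjoint_left]
    intro a ha hb
    simp only [Finset.mem_filter] at ha hb
    have := ori_swap' u v a
    linarith [ha.2, hb.2]

lemma filter_erase_zero (A : Finset Pt) (u v w : Pt) (hw : orient u v w = 0) :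
    (A.erase w).filter (fun a => 0 < orient u v a) = A.filter (fun a => 0 < orient u v a) := by
  ext a
  simp only [Finset.mem_filter, Finset.mem_erase]
  constructor
  · rintro ⟨⟨_, h1⟩, h2⟩; exact ⟨h1, h2⟩
  · rintro ⟨h1, h2⟩
    refine ⟨⟨?_, h1⟩, h2⟩
    rintro rfl; rw [hw] at h2; exact lt_irrefl _ h2

/-- Line through two points of `Z`. -/
lemma zz (h : Cfg Z R) {u v : Pt} (hu : u ∈ Z) (hv : v ∈ Z) (huv : u ≠ v) :
    (R.filter fun r => 0 < orient u v r).card = (Z.filter fun z => 0 < orient u v z).card + 2 := by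
  classical
  have h1 := h.half (S := R.filter fun r => 0 < orient u v r) (Finset.filter_subset _ _)
    (u := u) (v := v) (w := u) (fun s hs => Or.inr (Finset.mem_filter.1 hs).2) (by rw [ori_aba])
  have h2 := h.half (S := R.filter fun r => 0 < orient v u r) (Finset.filter_subset _ _)
    (u := v) (v := u) (w := u) (fun s hs => Or.inr (Finset.mem_filter.1 hs).2) (by rw [ori_abb])
  have h3 := card_split R u v fun r hr => h.gp u v r (Or.inl hu) (Or.inl hv) (Or.inr hr) huv
    (h.neZR hu hr) (h.neZR hv hr)
  have h4 := card_split ((Z.erase u).erase v) u v fun r hr => by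
    simp only [Finset.mem_erase] at hr
    exact h.gp u v r (Or.inl hu) (Or.inl hv) (Or.inl hr.2.2) huv (Ne.symm hr.2.1) (Ne.symm hr.1)
  rw [filter_erase_zero _ _ _ _ (ori_abb _ _), filter_erase_zero _ _ _ _ (ori_aba _ _),
    filter_erase_zero _ _ _ _ (ori_aba _ _), filter_erase_zero _ _ _ _ (ori_abb _ _),
    Finset.card_erase_of_mem (Finset.mem_erase.2 ⟨huv.symm, hv⟩), Finset.card_erase_of_mem hu] at h4
  have h5 := h.card_eq ⟨u, hu⟩
  have h6 : 1 < Z.card := Finset.one_lt_card.2 ⟨u, hu, v, hv, huv⟩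
  omega

/-- Line through a point of `R` and a point of `Z`. -/
lemma rz (h : Cfg Z R) {u v : Pt} (hu : u ∈ R) (hv : v ∈ Z) :
    (R.filter fun r => 0 < orient u v r).card = (Z.filter fun z => 0 < orient u v z).card + 1 ∧
    (R.filter fun r => 0 < orient v u r).card = (Z.filter fun z => 0 < orient v u z).card + 1 := by
  classical
  have huv : u ≠ v := (h.neZR hv hu).symm
  have h1 := h.half (S := insert u (R.filter fun r => 0 < orient u v r))
    (Finset.insert_subset hu (Finset.filter_subset _ _))
    (u := u) (v := v) (w := u) (fun s hs => by
      rcases Finset.mem_insert.1 hs with hs | hs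
      exacts [Or.inl hs, Or.inr (Finset.mem_filter.1 hs).2]) (by rw [ori_aba])
  have h2 := h.half (S := insert u (R.filter fun r => 0 < orient v u r))
    (Finset.insert_subset hu (Finset.filter_subset _ _))
    (u := v) (v := u) (w := u) (fun s hs => by
      rcases Finset.mem_insert.1 hs with hs | hs
      exacts [Or.inl hs, Or.inr (Finset.mem_filter.1 hs).2]) (by rw [ori_abb])
  rw [Finset.card_insert_of_notMem (by simp [ori_aba])] at h1
  rw [Finset.card_insert_of_notMem (by simp [ori_abb])] at h2
  have h3 := card_split (R.erase u) u v fun r hr => by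
    simp only [Finset.mem_erase] at hr
    exact h.gp u v r (Or.inr hu) (Or.inl hv) (Or.inr hr.2) huv (Ne.symm hr.1) (h.neZR hv hr.2)
  have h4 := card_split (Z.erase v) u v fun r hr => by
    simp only [Finset.mem_erase] at hr
    exact h.gp u v r (Or.inr hu) (Or.inl hv) (Or.inl hr.2) huv (h.neZR hr.2 hu).symm (Ne.symm hr.1)
  rw [filter_erase_zero _ _ _ _ (ori_aba _ _), filter_erase_zero _ _ _ _ (ori_abb _ _),
    Finset.card_erase_of_mem hu] at h3
  rw [filter_erase_zero _ _ _ _ (ori_abb _ _), filter_erase_zero _ _ _ _ (ori_aba _ _),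
    Finset.card_erase_of_mem hv] at h4
  have h5 := h.card_eq ⟨v, hv⟩
  have h6 := Finset.card_pos.2 ⟨v, hv⟩
  omega

end Cfg
end

section

lemma exists_tangent {S : Finset Pt} {q u : Pt} (hS : S.Nonempty) (hu : ∀ y ∈ S, 0 < adot u q y)
    (hg : ∀ a ∈ S, ∀ b ∈ S, a ≠ b → orient q a b ≠ 0) :
    (∃ t ∈ S, ∀ z ∈ S, z ≠ t → 0 < orient q t z) ∧
    (∃ t ∈ S, ∀ z ∈ S, z ≠ t → 0 < orient q z t) := by
  obtain ⟨θ, hθ⟩ := exists_theta q u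
  constructor
  · obtain ⟨t, ht, hm⟩ := S.exists_min_image θ hS
    refine ⟨t, ht, fun z hz hzt => ?_⟩
    refine ori_pos_swap (hg z hz t ht hzt) fun hc => ?_
    have := (hθ _ _ (hu z hz) (hu t ht)).1 hc
    linarith [hm z hz]
  · obtain ⟨t, ht, hm⟩ := S.exists_max_image θ hS
    refine ⟨t, ht, fun z hz hzt => ?_⟩
    refine ori_pos_swap (hg t ht z hz hzt.symm) fun hc => ?_
    have := (hθ _ _ (hu t ht) (hu z hz)).1 hc
    linarith [hm z hz]

/-- Directed hull edge of `Z`. -/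
def Edge (Z : Finset Pt) (p p' : Pt) : Prop :=
  p ∈ Z ∧ p' ∈ Z ∧ p ≠ p' ∧ ∀ z ∈ Z, z ≠ p → z ≠ p' → 0 < orient p p' z

lemma Edge.succ_unique {Z : Finset Pt} {p a b : Pt} (h : Edge Z p a) (h' : Edge Z p b) : a = b := by
  by_contra hne
  have h1 := h.2.2.2 b h'.2.1 h'.2.2.1.symm (Ne.symm hne)
  have h2 := h'.2.2.2 a h.2.1 h.2.2.1.symm hne
  have := ori_swap p a b
  linarith

lemma Edge.pred_unique {Z : Finset Pt} {p a b : Pt} (h : Edge Z a p) (h' : Edge Z b p) : a = b := by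
  by_contra hne
  have h1 := h.2.2.2 b h'.1 (Ne.symm hne) h'.2.2.1
  have h2 := h'.2.2.2 a h.1 hne h.2.2.1
  have := ori_rot a p b
  have := ori_rot b p a
  have := ori_swap p a b
  linarith

structure Cfg2 (Z R E : Finset Pt) : Prop extends Cfg Z R where
  hE : ∀ p, p ∈ E ↔ p ∈ Z ∧ p ∉ convexHull ℝ ((Z : Set Pt) \ {p})
  sepE : ∀ p ∈ E, ∃ u : Pt, ∀ z ∈ Z, z ≠ p → 0 < adot u p z
  two : 2 ≤ Z.card
  cardE : R.card = 2 * E.card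

namespace Cfg2
variable {Z R E : Finset Pt}

lemma edge_left (h : Cfg2 Z R E) {p p' : Pt} (he : Edge Z p p') : p ∈ E := by
  rw [h.hE]
  refine ⟨he.1, fun hc => ?_⟩
  have hside : ∀ y ∈ ((Z : Set Pt) \ {p}), y = p' ∨ 0 < orient p p' y := by
    intro y hy
    by_cases hyp : y = p'
    · exact Or.inl hyp
    · exact Or.inr (he.2.2.2 y hy.1 hy.2 hyp)
  rcases hull_half hside (by rw [ori_abb]) hc with h1 | h1
  · exact he.2.2.1 h1
  · rw [ori_aba] at h1; exact lt_irrefl _ h1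

lemma edge_right (h : Cfg2 Z R E) {p p' : Pt} (he : Edge Z p p') : p' ∈ E := by
  rw [h.hE]
  refine ⟨he.2.1, fun hc => ?_⟩
  have hside : ∀ y ∈ ((Z : Set Pt) \ {p'}), y = p ∨ 0 < orient p p' y := by
    intro y hy
    by_cases hyp : y = p
    · exact Or.inl hyp
    · exact Or.inr (he.2.2.2 y hy.1 hyp hy.2)
  rcases hull_half hside (by rw [ori_aba]) hc with h1 | h1
  · exact he.2.2.1 h1.symm
  · rw [ori_abb] at h1; exact lt_irrefl _ h1

lemma exists_edges (h : Cfg2 Z R E) {p : Pt} (hp : p ∈ E) :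
    (∃ s, Edge Z p s) ∧ (∃ o, Edge Z o p) := by
  obtain ⟨u, hu⟩ := h.sepE p hp
  have hpZ := ((h.hE p).1 hp).1
  have hne : (Z.erase p).Nonempty := by
    rw [← Finset.card_pos, Finset.card_erase_of_mem hpZ]; have := h.two; omega
  obtain ⟨⟨t, ht, h1⟩, ⟨t', ht', h2⟩⟩ := exists_tangent (S := Z.erase p) (q := p) (u := u) hne
    (fun y hy => hu y (Finset.mem_of_mem_erase hy) (Finset.ne_of_mem_erase hy))
    (fun a ha b hb hab => h.gp _ _ _ (Or.inl hpZ) (Or.inl (Finset.mem_of_mem_erase ha))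
      (Or.inl (Finset.mem_of_mem_erase hb)) (Finset.ne_of_mem_erase ha).symm
      (Finset.ne_of_mem_erase hb).symm hab)
  simp only [Finset.mem_erase] at *
  refine ⟨⟨t, hpZ, ht.2, ht.1.symm, fun z hz hzp hzt => h1 z ⟨hzp, hz⟩ hzt⟩,
    ⟨t', ht'.2, hpZ, ht'.1, fun z hz hzt hzp => ?_⟩⟩
  rw [ori_rot]; exact h2 z ⟨hzp, hz⟩ hzt

/-- Tangents from a point of `R` to `Z`; `t` has the rest of `Z` to the left of `r → t`. -/
lemma tangents (h : Cfg2 Z R E) {r : Pt} (hr : r ∈ R) :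
    (∃ t ∈ E, ∀ z ∈ Z, z ≠ t → 0 < orient r t z) ∧
    (∃ t ∈ E, ∀ z ∈ Z, z ≠ t → 0 < orient r z t) := by
  obtain ⟨u, hu⟩ := h.sep r hr
  have hne : Z.Nonempty := by
    rw [← Finset.card_pos]; have := h.two; omega
  obtain ⟨⟨t, ht, h1⟩, ⟨t', ht', h2⟩⟩ := exists_tangent (S := Z) (q := r) (u := u) hne
    (fun y hy => hu y (Or.inl hy) (h.neZR hy hr))
    (fun a ha b hb hab => h.gp _ _ _ (Or.inr hr) (Or.inl ha)
      (Or.inl hb) (h.neZR ha hr).symm (h.neZR hb hr).symm hab)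
  refine ⟨⟨t, ?_, h1⟩, ⟨t', ?_, h2⟩⟩
  · rw [h.hE]
    refine ⟨ht, fun hc => ?_⟩
    have hside : ∀ y ∈ ((Z : Set Pt) \ {t}), y = r ∨ 0 < orient r t y := by
      intro y hy
      exact Or.inr (h1 y hy.1 hy.2)
    rcases hull_half hside (by rw [ori_aba]) hc with h3 | h3
    · exact h.neZR ht hr h3
    · rw [ori_abb] at h3; exact lt_irrefl _ h3
  · rw [h.hE]
    refine ⟨ht', fun hc => ?_⟩
    have hside : ∀ y ∈ ((Z : Set Pt) \ {t'}), y = r ∨ 0 < orient t' r y := by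
      intro y hy
      right; rw [ori_rot]; exact h2 y hy.1 hy.2
    rcases hull_half hside (by rw [ori_abb]) hc with h3 | h3
    · exact h.neZR ht' hr h3
    · rw [ori_aba] at h3; exact lt_irrefl _ h3

/-- Exactly two points of `R` beyond each edge. -/
lemma beyond_two (h : Cfg2 Z R E) {p p' : Pt} (he : Edge Z p p') :
    (R.filter fun r => 0 < orient p' p r).card = 2 := by
  rw [h.zz he.2.1 he.1 he.2.2.1.symm]
  have : (Z.filter fun z => 0 < orient p' p z) = ∅ := by
    rw [Finset.filter_eq_empty_iff]
    intro z hz hc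
    by_cases h1 : z = p
    · subst h1; rw [ori_abb] at hc; exact lt_irrefl _ hc
    by_cases h2 : z = p'
    · subst h2; rw [ori_aba] at hc; exact lt_irrefl _ hc
    have := he.2.2.2 z hz h1 h2
    have := ori_swap' p p' z
    linarith
  rw [this]; rfl

/-- Every `r` is beyond exactly one edge. -/
lemma beyond_unique (h : Cfg2 Z R E) {p p' s s' r : Pt} (he : Edge Z p p') (he' : Edge Z s s')
    (hr : r ∈ R) (h1 : 0 < orient p' p r) (h2 : 0 < orient s' s r) : p = s ∧ p' = s' := by
  classical
  have hs : ∀ p ∈ E, ∃ s, Edge Z p s := fun p hp => (h.exists_edges hp).1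
  choose! sc hsc using hs
  have hdc := Finset.sum_card_bipartiteAbove_eq_sum_card_bipartiteBelow (s := R) (t := E)
    (fun r p => 0 < orient (sc p) p r)
  have hb : ∀ p ∈ E, (R.bipartiteBelow (fun r p => 0 < orient (sc p) p r) p).card = 2 :=
    fun p hp => h.beyond_two (hsc p hp)
  rw [Finset.sum_congr rfl hb, Finset.sum_const, smul_eq_mul, mul_comm, ← h.cardE] at hdc
  have hge : ∀ r ∈ R, 1 ≤ (E.bipartiteAbove (fun r p => 0 < orient (sc p) p r) r).card := by
    intro r hr
    obtain ⟨_, t, ht, h3⟩ := h.tangents hr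
    refine Finset.card_pos.2 ⟨t, ?_⟩
    rw [Finset.mem_bipartiteAbove]
    refine ⟨ht, ?_⟩
    have h4 := h3 (sc t) (hsc t ht).2.1 (hsc t ht).2.2.1.symm
    rwa [ori_rot] at h4
  have heq : ∀ r ∈ R, (E.bipartiteAbove (fun r p => 0 < orient (sc p) p r) r).card = 1 := by
    have h5 : ∑ r ∈ R, 1 = ∑ r ∈ R, (E.bipartiteAbove (fun r p => 0 < orient (sc p) p r) r).card := by
      rw [hdc]; simp
    intro r hr
    exact ((Finset.sum_eq_sum_iff_of_le hge).1 h5 r hr).symm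
  have hp := h.edge_left he
  have hs := h.edge_left he'
  have e1 : sc p = p' := (hsc p hp).succ_unique he
  have e2 : sc s = s' := (hsc s hs).succ_unique he'
  have hps : p = s := by
    refine Finset.card_le_one.1 (heq r hr).le p ?_ s ?_
    · rw [Finset.mem_bipartiteAbove]; exact ⟨hp, by rwa [e1]⟩
    · rw [Finset.mem_bipartiteAbove]; exact ⟨hs, by rwa [e2]⟩
  subst hps
  exact ⟨rfl, he.succ_unique he'⟩

lemma beyond_tangents (h : Cfg2 Z R E) {p p' r : Pt} (he : Edge Z p p')
    (hr : r ∈ R) (h1 : 0 < orient p' p r) :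
    (∀ z ∈ Z, z ≠ p' → 0 < orient r p' z) ∧ (∀ z ∈ Z, z ≠ p → 0 < orient r z p) := by
  obtain ⟨⟨t, ht, h2⟩, ⟨t', ht', h3⟩⟩ := h.tangents hr
  obtain ⟨_, o, ho⟩ := h.exists_edges ht
  obtain ⟨⟨s, hs⟩, _⟩ := h.exists_edges ht'
  have e1 := h.beyond_unique he ho hr h1 (by
    have := h2 o ho.1 ho.2.2.1
    rwa [ori_rot] at this)
  have e2 := h.beyond_unique he hs hr h1 (by
    have := h3 s hs.2.1 hs.2.2.1.symm
    rwa [ori_rot] at this)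
  rw [e1.2, e2.1]
  exact ⟨h2, h3⟩

/-- At most one point of `R` to the right of `r → p'`, when `r` is beyond `p p'`. -/
lemma one_right (h : Cfg2 Z R E) {p p' r : Pt} (he : Edge Z p p')
    (hr : r ∈ R) (h1 : 0 < orient p' p r) :
    (R.filter fun y => 0 < orient p' r y).card = 1 := by
  rw [(h.rz hr he.2.1).2]
  have : (Z.filter fun z => 0 < orient p' r z) = ∅ := by
    rw [Finset.filter_eq_empty_iff]
    intro z hz hc
    by_cases h2 : z = p'
    · subst h2; rw [ori_aba] at hc; exact lt_irrefl _ hc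
    have := (h.beyond_tangents he hr h1).1 z hz h2
    have := ori_swap' r p' z
    linarith
  rw [this]; rfl

lemma one_left (h : Cfg2 Z R E) {p p' r : Pt} (he : Edge Z p p')
    (hr : r ∈ R) (h1 : 0 < orient p' p r) :
    (R.filter fun y => 0 < orient r p y).card = 1 := by
  rw [(h.rz hr he.1).1]
  have : (Z.filter fun z => 0 < orient r p z) = ∅ := by
    rw [Finset.filter_eq_empty_iff]
    intro z hz hc
    by_cases h2 : z = p
    · subst h2; rw [ori_abb] at hc; exact lt_irrefl _ hc
    have := (h.beyond_tangents he hr h1).2 z hz h2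
    have := ori_swap r p z
    linarith
  rw [this]; rfl

/-- The two points beyond an edge, in order. -/
lemma edge_pair (h : Cfg2 Z R E) {p p' : Pt} (he : Edge Z p p') :
    ∃ a ∈ R, ∃ b ∈ R, a ≠ b ∧ 0 < orient p' p a ∧ 0 < orient p' p b ∧
      (∀ r ∈ R, 0 < orient p' p r → r = a ∨ r = b) ∧
      0 < orient b p' a ∧ 0 < orient b p a := by
  classical
  have hc := h.beyond_two he
  obtain ⟨a, b, hab, hS⟩ := Finset.card_eq_two.1 hc
  have hm : ∀ r, (r ∈ R ∧ 0 < orient p' p r) ↔ r = a ∨ r = b := by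
    intro r
    have : r ∈ (R.filter fun r => 0 < orient p' p r) ↔ r ∈ ({a, b} : Finset Pt) := by rw [hS]
    simpa using this
  clear hS hc
  -- geometric part
  have geo : ∀ a b, a ∈ R → b ∈ R → a ≠ b → 0 < orient p' p a → 0 < orient p' p b →
      0 < orient b p' a → 0 < orient b p a := by
    intro a b ha hb hab h1 h2 h3
    by_contra hn
    have h4 := ori_pos_swap (h.gp b p a (Or.inr hb) (Or.inl he.1) (Or.inr ha)
      (h.neZR he.1 hb).symm hab.symm (h.neZR he.1 ha)) hn
    refine h.notTri ha (Or.inr hb) (Or.inl he.2.1) (Or.inl he.1) ⟨h3, h1, ?_⟩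
    rwa [ori_rot]
  have ha := (hm a).2 (Or.inl rfl)
  have hb := (hm b).2 (Or.inr rfl)
  by_cases h3 : 0 < orient b p' a
  · exact ⟨a, ha.1, b, hb.1, hab, ha.2, hb.2, fun r hr h1 => (hm r).1 ⟨hr, h1⟩, h3,
      geo a b ha.1 hb.1 hab ha.2 hb.2 h3⟩
  · have h4 := ori_pos_swap (h.gp b p' a (Or.inr hb.1) (Or.inl he.2.1) (Or.inr ha.1)
      (h.neZR he.2.1 hb.1).symm hab.symm (h.neZR he.2.1 ha.1)) h3
    have h5 : 0 < orient a p' b := by rw [← ori_rot]; exact h4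
    exact ⟨b, hb.1, a, ha.1, hab.symm, hb.2, ha.2, fun r hr h1 => ((hm r).1 ⟨hr, h1⟩).symm, h5,
      geo b a hb.1 ha.1 hab.symm hb.2 ha.2 h5⟩

/-- `x, y` are adopted by `p`. -/
def Adopt (Z R : Finset Pt) (p x y : Pt) : Prop :=
  x ∈ R ∧ y ∈ R ∧ x ≠ y ∧ 0 < orient x y p ∧
  ∀ w, (w ∈ Z ∨ w ∈ R) → w ≠ p → w ≠ x → w ≠ y → 0 < orient x p w ∧ 0 < orient p y w

lemma exists_adopt (h : Cfg2 Z R E) {o p s a' b a b' : Pt} (he : Edge Z o p) (he' : Edge Z p s)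
    (hb : b ∈ R) (hbo : 0 < orient p o b)
    (hall : ∀ r ∈ R, 0 < orient p o r → r = a' ∨ r = b) (hba' : 0 < orient b p a')
    (ha : a ∈ R) (hb' : b' ∈ R) (has : 0 < orient s p a) (hbs : 0 < orient s p b')
    (hall' : ∀ r ∈ R, 0 < orient s p r → r = a ∨ r = b') (hba : 0 < orient b' p a) :
    Adopt Z R p b a := by
  have hpZ := he.2.1
  have hab : a ≠ b := by
    rintro rfl
    exact he.2.2.1 (h.beyond_unique he he' ha hbo has).1
  obtain ⟨r, hr⟩ := Finset.card_eq_one.1 (h.one_right he hb hbo)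
  have hm : ∀ y, (y ∈ R ∧ 0 < orient p b y) ↔ y = r := by
    intro y
    have : y ∈ (R.filter fun y => 0 < orient p b y) ↔ y ∈ ({r} : Finset Pt) := by rw [hr]
    simpa using this
  obtain ⟨hrR, hro⟩ := (hm r).2 rfl
  obtain ⟨tb1, tb2⟩ := h.beyond_tangents he hb hbo
  obtain ⟨ta1, ta2⟩ := h.beyond_tangents he' ha has
  have hrb : r ≠ b := by rintro rfl; rw [ori_abb] at hro; exact lt_irrefl _ hro
  have hra' : r ≠ a' := by
    rintro rfl
    have := ori_swap' p b r
    linarith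
  have hpr : p ≠ r := h.neZR hpZ hrR
  have hr2 : 0 < orient s p r := by
    by_contra hn
    have h1 := ori_pos_swap (h.gp s p r (Or.inl he'.2.1) (Or.inl hpZ) (Or.inr hrR)
      he'.2.2.1.symm (h.neZR he'.2.1 hrR) hpr) hn
    have h2 : ¬ 0 < orient p o r := by
      intro hc
      rcases hall r hrR hc with h3 | h3
      exacts [hra' h3, hrb h3]
    have h3 := ori_pos_swap (h.gp p o r (Or.inl hpZ) (Or.inl he.1) (Or.inr hrR)
      he.2.2.1.symm hpr (h.neZR he.1 hrR)) h2
    -- h1 : 0 < orient s r p, h3 : 0 < orient p r o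
    by_cases hos : o = s
    · subst hos
      have := ori_rot p r o
      have := ori_rot o p r
      have := ori_swap o r p
      linarith
    · have h4 := he.2.2.2 s he'.2.1 (Ne.symm hos) he'.2.2.1.symm
      have h5 := tb1 s he'.2.1 he'.2.2.1.symm
      have h6 := tb1 o he.1 he.2.2.1
      have key := ori_pl p b s r o
      have e1 : orient p b s = - orient b p s := ori_swap' _ _ _
      have e2 : orient p b o = - orient b p o := ori_swap' _ _ _
      have e3 : orient p s o = orient o p s := (ori_rot _ _ _).symm
      have e4 : orient p s r = orient s r p := (ori_rot _ _ _)
      rw [e1, e2, e3, e4] at key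
      have := mul_pos hro h4
      have := mul_pos h5 h3
      have := mul_pos h6 h1
      linarith
  have hra : r = a := by
    rcases hall' r hrR hr2 with h1 | h1
    · exact h1
    · exfalso
      obtain ⟨y, hy⟩ := Finset.card_eq_one.1 (h.one_left he' hb' hbs)
      have hm' : ∀ x, x ∈ R → 0 < orient b' p x → x = y := by
        intro x hx hx'
        have : x ∈ (R.filter fun y => 0 < orient b' p y) := Finset.mem_filter.2 ⟨hx, hx'⟩
        rw [hy] at this
        simpa using this
      have h2 := hm' a ha hba
      have h3 := hm' b hb (by rw [← h1, ori_rot]; exact hro)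
      exact hab (h2.trans h3.symm)
  subst hra
  have hpb := h.neZR hpZ hb
  refine ⟨hb, ha, hrb.symm, by rw [← ori_rot]; exact hro, ?_⟩
  intro w hw hwp hwb hwr
  rcases hw with hw | hw
  · refine ⟨tb1 w hw hwp, ?_⟩
    have := ta2 w hw hwp
    rwa [ori_rot, ori_rot] at this
  · constructor
    · by_contra hn
      have h1 := ori_pos_swap (h.gp b p w (Or.inr hb) (Or.inl hpZ) (Or.inr hw) hpb.symm
        hwb.symm hwp.symm) hn
      exact hwr ((hm w).1 ⟨hw, by rwa [ori_rot, ori_rot] at h1⟩)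
    · obtain ⟨y, hy⟩ := Finset.card_eq_one.1 (h.one_left he' ha has)
      have hm' : ∀ x, x ∈ R → 0 < orient r p x → x = y := by
        intro x hx hx'
        have : x ∈ (R.filter fun y => 0 < orient r p y) := Finset.mem_filter.2 ⟨hx, hx'⟩
        rw [hy] at this
        simpa using this
      by_contra hn
      have h1 := ori_pos_swap (h.gp p r w (Or.inl hpZ) (Or.inr hrR) (Or.inr hw) hpr
        hwp.symm hwr.symm) hn
      have h2 := hm' w hw (by rwa [ori_rot, ori_rot] at h1)
      have h3 := hm' b hb (by rw [ori_rot]; exact hro)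
      exact hwb (h2.trans h3.symm)

end Cfg2
end

section

lemma ori_trans' {o u a b c : Pt} (ha : 0 < orient u o a) (hb : 0 < orient u o b)
    (hc : 0 < orient u o c) (h1 : 0 < orient o a b) (h2 : 0 < orient o b c) :
    0 < orient o a c := by
  have := ori_pl o u a b c
  rw [ori_swap' o u a, ori_swap' o u b, ori_swap' o u c] at this
  have h3 : 0 < orient u o b * orient o a c := by nlinarith [mul_pos ha h2, mul_pos hc h1]
  exact (mul_pos_iff_of_pos_left hb).1 h3

namespace Cfg2
variable {Z R E : Finset Pt}

/-- Admissible third points for `Adopt`. -/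
def Oth (Z R : Finset Pt) (p x y w : Pt) : Prop := (w ∈ Z ∨ w ∈ R) ∧ w ≠ p ∧ w ≠ x ∧ w ≠ y

lemma adopt_xy {p x y w : Pt} (A : Adopt Z R p x y) (hw : Oth Z R p x y w) : 0 < orient x y w := by
  obtain ⟨h1, h2⟩ := A.2.2.2.2 w hw.1 hw.2.1 hw.2.2.1 hw.2.2.2
  have h3 := A.2.2.2.1
  have := ori_split x y w p
  have := ori_rot p y w
  have := ori_rot w x p
  linarith

lemma adopt_tri {p x y a : Pt} (A : Adopt Z R p x y) (ha : Oth Z R p x y a) : InTri x y a p := by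
  obtain ⟨h1, h2⟩ := A.2.2.2.2 a ha.1 ha.2.1 ha.2.2.1 ha.2.2.2
  exact ⟨A.2.2.2.1, by rwa [← ori_rot], by rwa [ori_rot]⟩

lemma noTri_x (h : Cfg2 Z R E) {p x y a b : Pt} (hp : p ∈ Z) (A : Adopt Z R p x y)
    (ha : Oth Z R p x y a) (hb : Oth Z R p x y b) (hR : a ∈ R ∨ b ∈ R) : ¬ InTri x p a b := by
  intro ht
  by_cases hbR : b ∈ R
  · exact h.notTri hbR (Or.inr A.1) (Or.inl hp) ha.1 ht
  have haR := hR.resolve_right hbR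
  have hbZ := hb.1.resolve_right hbR
  have t1 := adopt_tri A ha
  have t2 : InTri x y a b := by
    have k1 := adopt_xy A ha
    have k := ori_bary x p a y a b
    have kp := ht.pos
    obtain ⟨q1, q2, q3⟩ := ht
    refine ⟨adopt_xy A hb, ?_, q3⟩
    rw [ori_abb, mul_zero, add_zero, ← ori_rot x y a] at k
    refine (mul_pos_iff_of_pos_left kp).1 ?_
    rw [k]
    have := t1.2.1
    positivity
  exact hb.2.1 (h.un x A.1 y A.2.1 a haR b hbZ p hp t2 t1)

lemma noTri_y (h : Cfg2 Z R E) {p x y a b : Pt} (hp : p ∈ Z) (A : Adopt Z R p x y)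
    (ha : Oth Z R p x y a) (hb : Oth Z R p x y b) (hR : a ∈ R ∨ b ∈ R) : ¬ InTri p y a b := by
  intro ht
  by_cases hbR : b ∈ R
  · exact h.notTri hbR (Or.inl hp) (Or.inr A.2.1) ha.1 ht
  have haR := hR.resolve_right hbR
  have hbZ := hb.1.resolve_right hbR
  have t1 := adopt_tri A ha
  have t2 : InTri x y a b := by
    have k1 := adopt_xy A ha
    have k := ori_bary p y a a x b
    have kp := ht.pos
    obtain ⟨q1, q2, q3⟩ := ht
    refine ⟨adopt_xy A hb, q2, ?_⟩
    rw [ori_aba a x, mul_zero, add_zero, ori_rot a x y] at k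
    refine (mul_pos_iff_of_pos_left kp).1 ?_
    rw [k]
    have := t1.2.2
    positivity
  exact hb.2.1 (h.un x A.1 y A.2.1 a haR b hbZ p hp t2 t1)

lemma iff_x_aux (h : Cfg2 Z R E) {p x y a b : Pt} (hp : p ∈ Z) (A : Adopt Z R p x y)
    (ha : Oth Z R p x y a) (hb : Oth Z R p x y b) (hab : a ≠ b)
    (n1 : ¬ InTri x p a b) (n2 : ¬ InTri x p b a) :
    0 < orient x a b ↔ 0 < orient p a b := by
  have a1 := (A.2.2.2.2 a ha.1 ha.2.1 ha.2.2.1 ha.2.2.2).1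
  have b1 := (A.2.2.2.2 b hb.1 hb.2.1 hb.2.2.1 hb.2.2.2).1
  constructor
  · intro h1
    by_contra hn
    have := ori_pos_swap (h.gp p a b (Or.inl hp) ha.1 hb.1 ha.2.1.symm hb.2.1.symm hab) hn
    exact n2 ⟨a1, this, by rwa [ori_rot]⟩
  · intro h1
    by_contra hn
    have := ori_pos_swap (h.gp x a b (Or.inr A.1) ha.1 hb.1 ha.2.2.1.symm hb.2.2.1.symm hab) hn
    exact n1 ⟨b1, h1, by rwa [ori_rot]⟩

lemma iff_y_aux (h : Cfg2 Z R E) {p x y a b : Pt} (hp : p ∈ Z) (A : Adopt Z R p x y)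
    (ha : Oth Z R p x y a) (hb : Oth Z R p x y b) (hab : a ≠ b)
    (n1 : ¬ InTri p y a b) (n2 : ¬ InTri p y b a) :
    0 < orient y a b ↔ 0 < orient p a b := by
  have a1 := (A.2.2.2.2 a ha.1 ha.2.1 ha.2.2.1 ha.2.2.2).2
  have b1 := (A.2.2.2.2 b hb.1 hb.2.1 hb.2.2.1 hb.2.2.2).2
  constructor
  · intro h1
    by_contra hn
    have := ori_pos_swap (h.gp p a b (Or.inl hp) ha.1 hb.1 ha.2.1.symm hb.2.1.symm hab) hn
    exact n1 ⟨b1, h1, by rwa [ori_rot]⟩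
  · intro h1
    by_contra hn
    have := ori_pos_swap (h.gp y a b (Or.inr A.2.1) ha.1 hb.1 ha.2.2.2.symm hb.2.2.2.symm hab) hn
    exact n2 ⟨a1, this, by rwa [ori_rot]⟩

lemma oth_Z (h : Cfg2 Z R E) {p x y z : Pt} (A : Adopt Z R p x y) (hz : z ∈ Z) (hzp : z ≠ p) :
    Oth Z R p x y z := ⟨Or.inl hz, hzp, h.neZR hz A.1, h.neZR hz A.2.1⟩

lemma interp (h : Cfg2 Z R E) {p x y a b : Pt} (hp : p ∈ Z) (A : Adopt Z R p x y)
    (ha : a ∈ Z) (hap : a ≠ p) (hb : b ∈ Z) (hbp : b ≠ p) (h1 : 0 < orient p a b) :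
    ∃ r ∈ R, Oth Z R p x y r ∧ 0 < orient p a r ∧ 0 < orient p r b := by
  have key : ∀ w ∈ Z, w ≠ p → 0 < orient x p w := fun w hw hwp =>
    (A.2.2.2.2 w (Or.inl hw) hwp (h.neZR hw A.1) (h.neZR hw A.2.1)).1
  have hcard : (R.filter fun r => 0 < orient a p r).card < (R.filter fun r => 0 < orient b p r).card := by
    rw [h.zz ha hp hap, h.zz hb hp hbp]
    refine Nat.add_lt_add_right (Finset.card_lt_card ?_) 2
    rw [Finset.ssubset_iff_of_subset]
    · refine ⟨a, Finset.mem_filter.2 ⟨ha, ?_⟩, ?_⟩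
      · rwa [ori_rot]
      · simp [ori_aba]
    · intro w hw
      obtain ⟨hw, hw'⟩ := Finset.mem_filter.1 hw
      refine Finset.mem_filter.2 ⟨hw, ?_⟩
      have hwp : w ≠ p := by rintro rfl; rw [ori_abb] at hw'; exact lt_irrefl _ hw'
      rw [ori_rot]
      rw [ori_rot] at hw'
      exact ori_trans' (key w hw hwp) (key a ha hap) (key b hb hbp) hw' h1
  obtain ⟨r, hr, hr'⟩ := Finset.exists_mem_notMem_of_card_lt_card hcard
  obtain ⟨hrR, hrb⟩ := Finset.mem_filter.1 hr
  have hra : ¬ 0 < orient a p r := fun hc => hr' (Finset.mem_filter.2 ⟨hrR, hc⟩)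
  have h2 := ori_pos_swap (h.gp a p r (Or.inl ha) (Or.inl hp) (Or.inr hrR) hap (h.neZR ha hrR)
    (h.neZR hp hrR)) hra
  refine ⟨r, hrR, ⟨Or.inr hrR, (h.neZR hp hrR).symm, ?_, ?_⟩, ?_, ?_⟩
  · rintro rfl
    have := key b hb hbp
    have := ori_rot r p b
    have := ori_rot p b r
    have := ori_rot b p r
    have := ori_swap p r b
    linarith
  · rintro rfl
    have := (A.2.2.2.2 a (Or.inl ha) hap (h.neZR ha A.1) (h.neZR ha A.2.1)).2
    apply hra
    rwa [ori_rot]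
  · rwa [ori_rot, ori_rot] at h2
  · rwa [← ori_rot]

lemma iff_x (h : Cfg2 Z R E) {p x y a b : Pt} (hp : p ∈ Z) (A : Adopt Z R p x y)
    (ha : Oth Z R p x y a) (hb : Oth Z R p x y b) (hab : a ≠ b) :
    0 < orient x a b ↔ 0 < orient p a b := by
  by_cases hR : a ∈ R ∨ b ∈ R
  · exact h.iff_x_aux hp A ha hb hab (h.noTri_x hp A ha hb hR) (h.noTri_x hp A hb ha hR.symm)
  push Not at hR
  have haZ := ha.1.resolve_right hR.1
  have hbZ := hb.1.resolve_right hR.2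
  have key : ∀ a b, a ∈ Z → b ∈ Z → a ≠ b → Oth Z R p x y a → Oth Z R p x y b → ¬ InTri x p a b := by
    intro a b haZ hbZ hab ha hb ht
    obtain ⟨r, hr, hro, h1, h2⟩ := h.interp hp A haZ ha.2.1 hbZ hb.2.1 ht.2.1
    have h3 := (h.iff_x_aux hp A ha hro (h.neZR haZ hr) (h.noTri_x hp A ha hro (Or.inr hr))
      (h.noTri_x hp A hro ha (Or.inl hr))).2 h1
    have h4 := (h.iff_x_aux hp A hro hb (h.neZR hbZ hr).symm (h.noTri_x hp A hro hb (Or.inl hr))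
      (h.noTri_x hp A hb hro (Or.inr hr))).2 h2
    have q := fun w (hw : Oth Z R p x y w) => (A.2.2.2.2 w hw.1 hw.2.1 hw.2.2.1 hw.2.2.2).1
    have h5 := ori_trans (q a ha) (q r hro) (q b hb) h3 h4
    have := ht.2.2
    have := ori_rot a x b
    have := ori_swap x a b
    linarith
  exact h.iff_x_aux hp A ha hb hab (key a b haZ hbZ hab ha hb) (key b a hbZ haZ hab.symm hb ha)

lemma iff_y (h : Cfg2 Z R E) {p x y a b : Pt} (hp : p ∈ Z) (A : Adopt Z R p x y)
    (ha : Oth Z R p x y a) (hb : Oth Z R p x y b) (hab : a ≠ b) :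
    0 < orient y a b ↔ 0 < orient p a b := by
  by_cases hR : a ∈ R ∨ b ∈ R
  · exact h.iff_y_aux hp A ha hb hab (h.noTri_y hp A ha hb hR) (h.noTri_y hp A hb ha hR.symm)
  push Not at hR
  have haZ := ha.1.resolve_right hR.1
  have hbZ := hb.1.resolve_right hR.2
  have key : ∀ a b, a ∈ Z → b ∈ Z → a ≠ b → Oth Z R p x y a → Oth Z R p x y b → ¬ InTri p y a b := by
    intro a b haZ hbZ hab ha hb ht
    obtain ⟨r, hr, hro, h1, h2⟩ := h.interp hp A hbZ hb.2.1 haZ ha.2.1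
      (by rw [← ori_rot]; exact ht.2.2)
    have h3 := (h.iff_y_aux hp A hb hro (h.neZR hbZ hr) (h.noTri_y hp A hb hro (Or.inr hr))
      (h.noTri_y hp A hro hb (Or.inl hr))).2 h1
    have h4 := (h.iff_y_aux hp A hro ha (h.neZR haZ hr).symm (h.noTri_y hp A hro ha (Or.inl hr))
      (h.noTri_y hp A ha hro (Or.inr hr))).2 h2
    have q := fun w (hw : Oth Z R p x y w) => (A.2.2.2.2 w hw.1 hw.2.1 hw.2.2.1 hw.2.2.2).2
    have h5 := ori_trans' (q b hb) (q r hro) (q a ha) h3 h4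
    have := ht.2.1
    have := ori_swap y a b
    linarith
  exact h.iff_y_aux hp A ha hb hab (key a b haZ hbZ hab ha hb) (key b a hbZ haZ hab.symm hb ha)

lemma exists_children (h : Cfg2 Z R E) : ∃ f g : Pt → Pt, (∀ p ∈ E, Adopt Z R p (f p) (g p)) ∧
    (∀ p ∈ E, ∀ q ∈ E, f p = f q → p = q) ∧ (∀ p ∈ E, ∀ q ∈ E, g p = g q → p = q) ∧
    (∀ p ∈ E, ∀ q ∈ E, f p ≠ g q) ∧ (∀ r ∈ R, ∃ p ∈ E, r = f p ∨ r = g p) := by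
  have hs : ∀ p ∈ E, ∃ s, Edge Z p s := fun p hp => (h.exists_edges hp).1
  have ho : ∀ p ∈ E, ∃ o, Edge Z o p := fun p hp => (h.exists_edges hp).2
  choose! sc hsc using hs
  choose! pr hpr using ho
  have hpairs : ∀ p ∈ E, ∃ a b, a ∈ R ∧ b ∈ R ∧ a ≠ b ∧ 0 < orient (sc p) p a ∧
      0 < orient (sc p) p b ∧ (∀ r ∈ R, 0 < orient (sc p) p r → r = a ∨ r = b) ∧
      0 < orient b (sc p) a ∧ 0 < orient b p a := by
    intro p hp
    obtain ⟨a, ha, b, hb, hh⟩ := h.edge_pair (hsc p hp)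
    exact ⟨a, b, ha, hb, hh⟩
  choose! a b haR hbR hab hao hbo hall h1 h2 using hpairs
  have hprE : ∀ p ∈ E, pr p ∈ E := fun p hp => h.edge_left (hpr p hp)
  have hscE : ∀ p ∈ E, sc p ∈ E := fun p hp => h.edge_right (hsc p hp)
  have hscpr : ∀ p ∈ E, sc (pr p) = p := fun p hp =>
    (hsc _ (hprE p hp)).succ_unique (hpr p hp)
  have hprsc : ∀ p ∈ E, pr (sc p) = p := fun p hp =>
    (hpr _ (hscE p hp)).pred_unique (hsc p hp)
  refine ⟨fun p => b (pr p), a, ?_, ?_, ?_, ?_, ?_⟩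
  · intro p hp
    have hq := hprE p hp
    have e := hscpr p hp
    refine h.exists_adopt (a' := a (pr p)) (b' := b p) (hpr p hp) (hsc p hp) (hbR _ hq) ?_ ?_ ?_
      (haR p hp) (hbR p hp) (hao p hp) (hbo p hp) (hall p hp) (h2 p hp)
    · have := hbo _ hq; rwa [e] at this
    · have := hall _ hq; rwa [e] at this
    · have := h1 _ hq; rwa [e] at this
  · intro p hp q hq he
    have e1 := hbo _ (hprE p hp)
    have e2 := hbo _ (hprE q hq)
    simp only at he
    rw [← he] at e2
    have := (h.beyond_unique (hsc _ (hprE p hp)) (hsc _ (hprE q hq)) (hbR _ (hprE p hp)) e1 e2).2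
    rwa [hscpr p hp, hscpr q hq] at this
  · intro p hp q hq he
    have e2 := hao q hq
    rw [← he] at e2
    exact (h.beyond_unique (hsc p hp) (hsc q hq) (haR p hp) (hao p hp) e2).1
  · intro p hp q hq he
    have e1 := hbo _ (hprE p hp)
    have e2 := hao q hq
    simp only at he
    rw [← he] at e2
    have := (h.beyond_unique (hsc _ (hprE p hp)) (hsc q hq) (hbR _ (hprE p hp)) e1 e2).1
    rw [this] at he
    exact hab q hq he.symm
  · intro r hr
    obtain ⟨_, t, ht, h3⟩ := h.tangents hr
    have h4 := h3 (sc t) (hsc t ht).2.1 (hsc t ht).2.2.1.symm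
    rw [ori_rot] at h4
    rcases hall t ht r hr h4 with h5 | h5
    · exact ⟨t, ht, Or.inr h5⟩
    · exact ⟨sc t, hscE t ht, Or.inl (by simp only [hprsc t ht, h5])⟩

end Cfg2

/-- The combinatorial structure of one step: the points of `E` are tripled. -/
structure Tripled (X Z E : Set Pt) (c : Fin 3 → Pt → Pt) : Prop where
  mem : ∀ p ∈ Z, ∀ s, (s = 1 ∨ p ∈ E) → c s p ∈ X
  surj : ∀ x ∈ X, ∃ p ∈ Z, ∃ s, (s = 1 ∨ p ∈ E) ∧ c s p = x
  inj : ∀ p ∈ Z, ∀ q ∈ Z, ∀ s t, (s = 1 ∨ p ∈ E) → (t = 1 ∨ q ∈ E) → c s p = c t q → p = q ∧ s = t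
  far : ∀ p ∈ Z, ∀ q ∈ Z, ∀ r ∈ Z, ∀ s t u, (s = 1 ∨ p ∈ E) → (t = 1 ∨ q ∈ E) → (u = 1 ∨ r ∈ E) →
    p ≠ q → p ≠ r → q ≠ r → (0 < orient (c s p) (c t q) (c u r) ↔ 0 < orient p q r)
  near : ∀ p ∈ E, ∀ r ∈ Z, ∀ s t u, (u = 1 ∨ r ∈ E) → p ≠ r → s < t →
    0 < orient (c s p) (c t p) (c u r)
  self : ∀ p ∈ E, 0 < orient (c 0 p) (c 2 p) (c 1 p)

lemma Cfg2.tripled {Z R E : Finset Pt} (h : Cfg2 Z R E) :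
    ∃ c, Tripled ((Z : Set Pt) ∪ R) Z E c := by
  obtain ⟨f, g, hA, hf, hg, hfg, hsurj⟩ := h.exists_children
  have hEZ : ∀ p ∈ E, p ∈ Z := fun p hp => ((h.hE p).1 hp).1
  let c : Fin 3 → Pt → Pt := ![f, id, g]
  have c0 : ∀ p, c 0 p = f p := fun p => rfl
  have c1 : ∀ p, c 1 p = p := fun p => rfl
  have c2 : ∀ p, c 2 p = g p := fun p => rfl
  have hmem : ∀ p ∈ Z, ∀ s, (s = 1 ∨ p ∈ E) → c s p ∈ Z ∨ c s p ∈ R := by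
    intro p hp s hs
    fin_cases s
    · exact Or.inr (hA p (hs.resolve_left (by decide))).1
    · exact Or.inl hp
    · exact Or.inr (hA p (hs.resolve_left (by decide))).2.1
  have hinj : ∀ p ∈ Z, ∀ q ∈ Z, ∀ s t, (s = 1 ∨ p ∈ E) → (t = 1 ∨ q ∈ E) → c s p = c t q →
      p = q ∧ s = t := by
    intro p hp q hq s t hs ht he
    have kf : ∀ p ∈ E, ∀ q ∈ Z, f p ≠ q := fun p hp q hq => (h.neZR hq (hA p hp).1).symm
    have kg : ∀ p ∈ E, ∀ q ∈ Z, g p ≠ q := fun p hp q hq => (h.neZR hq (hA p hp).2.1).symm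
    fin_cases s <;> fin_cases t
    · exact ⟨hf p (hs.resolve_left (by decide)) q (ht.resolve_left (by decide)) he, rfl⟩
    · exact absurd he (kf p (hs.resolve_left (by decide)) q hq)
    · exact absurd he (hfg p (hs.resolve_left (by decide)) q (ht.resolve_left (by decide)))
    · exact absurd he.symm (kf q (ht.resolve_left (by decide)) p hp)
    · exact ⟨he, rfl⟩
    · exact absurd he.symm (kg q (ht.resolve_left (by decide)) p hp)
    · exact absurd he.symm (hfg q (ht.resolve_left (by decide)) p (hs.resolve_left (by decide)))
    · exact absurd he (kg p (hs.resolve_left (by decide)) q hq)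
    · exact ⟨hg p (hs.resolve_left (by decide)) q (ht.resolve_left (by decide)) he, rfl⟩
  have hoth : ∀ p ∈ E, ∀ q ∈ Z, ∀ t, (t = 1 ∨ q ∈ E) → p ≠ q →
      Cfg2.Oth Z R p (f p) (g p) (c t q) := by
    intro p hp q hq t ht hpq
    refine ⟨hmem q hq t ht, fun he => ?_, fun he => ?_, fun he => ?_⟩
    · exact hpq (hinj q hq p (hEZ p hp) t 1 ht (Or.inl rfl) he).1.symm
    · exact hpq (hinj q hq p (hEZ p hp) t 0 ht (Or.inr hp) he).1.symm
    · exact hpq (hinj q hq p (hEZ p hp) t 2 ht (Or.inr hp) he).1.symm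
  have hsame : ∀ p ∈ Z, ∀ q ∈ Z, ∀ r ∈ Z, ∀ s t u, (s = 1 ∨ p ∈ E) → (t = 1 ∨ q ∈ E) →
      (u = 1 ∨ r ∈ E) → p ≠ q → p ≠ r → q ≠ r →
      (0 < orient (c s p) (c t q) (c u r) ↔ 0 < orient p (c t q) (c u r)) := by
    intro p hp q hq r hr s t u hs ht hu hpq hpr hqr
    have hne : c t q ≠ c u r := fun he => hqr (hinj q hq r hr t u ht hu he).1
    fin_cases s
    · have hpE := hs.resolve_left (by decide)
      exact h.iff_x hp (hA p hpE) (hoth p hpE q hq t ht hpq) (hoth p hpE r hr u hu hpr) hne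
    · exact Iff.rfl
    · have hpE := hs.resolve_left (by decide)
      exact h.iff_y hp (hA p hpE) (hoth p hpE q hq t ht hpq) (hoth p hpE r hr u hu hpr) hne
  refine ⟨c, ⟨hmem, ?_, hinj, ?_, ?_, ?_⟩⟩
  · rintro x (hx | hx)
    · exact ⟨x, hx, 1, Or.inl rfl, rfl⟩
    · obtain ⟨p, hp, hp' | hp'⟩ := hsurj x hx
      · exact ⟨p, hEZ p hp, 0, Or.inr hp, hp'.symm⟩
      · exact ⟨p, hEZ p hp, 2, Or.inr hp, hp'.symm⟩
  · intro p hp q hq r hr s t u hs ht hu hpq hpr hqr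
    rw [hsame p hp q hq r hr s t u hs ht hu hpq hpr hqr, ← c1 p, ori_rot,
      hsame q hq r hr p hp t u 1 ht hu (Or.inl rfl) hqr hpq.symm hpr.symm, ← c1 q, ori_rot,
      hsame r hr p hp q hq u 1 1 hu (Or.inl rfl) (Or.inl rfl) hpr.symm hqr.symm hpq, ori_rot]
  · intro p hp r hr s t u hu hpr hst
    have ho := hoth p hp r hr u hu hpr
    have h1 := (hA p hp).2.2.2.2 _ ho.1 ho.2.1 ho.2.2.1 ho.2.2.2
    have h2 := Cfg2.adopt_xy (hA p hp) ho
    fin_cases s <;> fin_cases t <;> first | exact absurd hst (by decide) | exact h1.1 | exact h2 | exact h1.2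
  · intro p hp
    exact (hA p hp).2.2.2.1
end

section

lemma hull_compact {S : Set Pt} (hS : S.Finite) : IsCompact (convexHull ℝ S) :=
  hS.isCompact_convexHull ℝ

lemma exists_sep {T : Set Pt} {p : Pt} (hT : T.Finite) (hp : p ∉ convexHull ℝ T) :
    ∃ u : Pt, ∀ y ∈ T, 0 < adot u p y := by
  obtain ⟨f, v, h1, h2⟩ := geometric_hahn_banach_point_closed (convex_convexHull ℝ T)
    (hull_compact hT).isClosed hp
  refine ⟨(f (1, 0), f (0, 1)), fun y hy => ?_⟩
  have h3 := h2 y (subset_convexHull ℝ T hy)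
  have h4 : ∀ z : Pt, f z = z.1 * f (1, 0) + z.2 * f (0, 1) := by
    intro z
    have : z = z.1 • ((1 : ℝ), (0 : ℝ)) + z.2 • ((0 : ℝ), (1 : ℝ)) := by
      ext <;> simp
    conv_lhs => rw [this]
    rw [map_add, map_smul, map_smul]; simp
  rw [h4 p] at h1; rw [h4 y] at h3
  unfold adot
  simp only
  linarith

lemma mem_ext {S : Set Pt} (hS : S.Finite) (p : Pt) :
    p ∈ extremePts S ↔ p ∈ S ∧ p ∉ convexHull ℝ (S \ {p}) := by
  constructor
  · intro h
    refine ⟨extremePoints_convexHull_subset h, ?_⟩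
    have h2 := ((convex_convexHull ℝ S).mem_extremePoints_iff_mem_sdiff_convexHull_sdiff).1 h
    intro h3
    exact h2.2 (convexHull_mono (sdiff_subset_sdiff_left (subset_convexHull ℝ S)) h3)
  · rintro ⟨h1, h2⟩
    obtain ⟨u, hu⟩ := exists_sep (hS.subset sdiff_subset) h2
    have hc : Convex ℝ {y : Pt | y = p ∨ 0 < adot u p y} := by
      intro x hx y hy a b ha hb hab
      simp only [mem_ofPred_eq] at hx hy ⊢
      have e : adot u p (a • x + b • y) = a * adot u p x + b * adot u p y := by
        have : b = 1 - a := by linarith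
        subst this
        unfold adot; simp; ring
      have e0 : adot u p p = 0 := by unfold adot; ring
      rcases hx with rfl | hx <;> rcases hy with rfl | hy
      · left; rw [← add_smul, hab, one_smul]
      · rcases hb.eq_or_lt with rfl | hb
        · left; simp at hab; simp [hab]
        · right; rw [e, e0]; have := mul_pos hb hy; linarith
      · rcases ha.eq_or_lt with rfl | ha
        · left; simp at hab; simp [hab]
        · right; rw [e, e0]; have := mul_pos ha hx; linarith
      · right; rw [e]
        rcases ha.eq_or_lt with rfl | ha
        · simp at hab; simp [hab, hy]
        · have := mul_pos ha hx; have := mul_nonneg hb hy.le; linarith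
    have hsub : convexHull ℝ S ⊆ {y : Pt | y = p ∨ 0 < adot u p y} := by
      refine convexHull_min (fun y hy => ?_) hc
      by_cases hyp : y = p
      · exact Or.inl hyp
      · exact Or.inr (hu y ⟨hy, hyp⟩)
    refine ⟨subset_convexHull ℝ S h1, ?_⟩
    rintro x hx y hy ⟨a, b, ha, hb, hab, hxy⟩
    by_contra hne
    have hx' := (hsub hx).resolve_left hne
    have hy' : 0 ≤ adot u p y := by
      rcases hsub hy with rfl | h
      · unfold adot; simp
      · exact h.le
    have e : adot u p (a • x + b • y) = a * adot u p x + b * adot u p y := by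
      have : b = 1 - a := by linarith
      subst this
      unfold adot; simp; ring
    rw [hxy] at e
    have e0 : adot u p p = 0 := by unfold adot; ring
    have := mul_pos ha hx'; have := mul_nonneg hb.le hy'
    linarith

lemma ext_sub (S : Set Pt) : extremePts S ⊆ S := extremePoints_convexHull_subset

lemma ext_sep {S : Set Pt} (hS : S.Finite) {p : Pt} (hp : p ∈ extremePts S) :
    ∃ u : Pt, ∀ y ∈ S, y ≠ p → 0 < adot u p y := by
  obtain ⟨u, hu⟩ := exists_sep (hS.subset sdiff_subset) ((mem_ext hS p).1 hp).2
  exact ⟨u, fun y hy hne => hu y ⟨hy, hne⟩⟩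

lemma hull_ext {S : Set Pt} (hS : S.Finite) : convexHull ℝ (extremePts S) = convexHull ℝ S := by
  have h : closure (convexHull ℝ (extremePts S)) = _ := closure_convexHull_extremePoints (hull_compact hS) (convex_convexHull ℝ S)
  rwa [(hull_compact (hS.subset (ext_sub S))).isClosed.closure_eq] at h

lemma ext_nonempty {S : Set Pt} (hS : S.Finite) (hn : S.Nonempty) : (extremePts S).Nonempty :=
  (hull_compact hS).extremePoints_nonempty hn.convexHull

lemma peel_ssub {S : Set Pt} (hS : S.Finite) (hn : S.Nonempty) : peel S ⊂ S := by
  refine ⟨sdiff_subset, fun h => ?_⟩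
  obtain ⟨p, hp⟩ := ext_nonempty hS hn
  exact (h (ext_sub S hp)).2 hp

lemma exists_layers {S : Set Pt} (hS : S.Finite) : ∃ k, HasLayers S k := by
  have : ∀ n, ∀ S : Set Pt, S.Finite → S.ncard ≤ n → ∃ k, peel^[k] S = ∅ := by
    intro n
    induction n with
    | zero =>
      intro S hS hc
      exact ⟨0, (Set.ncard_eq_zero hS).1 (by omega)⟩
    | succ n ih =>
      intro S hS hc
      rcases S.eq_empty_or_nonempty with rfl | hn
      · exact ⟨0, rfl⟩
      · have := Set.ncard_lt_ncard (peel_ssub hS hn) hS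
        obtain ⟨k, hk⟩ := ih (peel S) (hS.subset sdiff_subset) (by omega)
        exact ⟨k + 1, hk⟩
  classical
  have hex := this _ S hS le_rfl
  exact ⟨Nat.find hex, Nat.find_spec hex, fun j hj => Nat.find_min hex hj⟩

/-- The condition on the outermost layer only. -/
def TopCond (X : Set Pt) : Prop :=
  ∀ a ∈ extremePts X, ∀ b ∈ extremePts X, ∀ c ∈ extremePts X, a ≠ b → a ≠ c → b ≠ c →
    ∃! p : Pt, p ∈ peel X ∩ interior (convexHull ℝ ({a, b, c} : Set Pt))

lemma nacs_top {X : Set Pt} (h : IsNACS X) : TopCond X := by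
  obtain ⟨hf, hn, -, h⟩ := h
  obtain ⟨k, hk⟩ := exists_layers hf
  have hk1 : 1 ≤ k := by
    by_contra hc
    have : k = 0 := by omega
    subst this
    exact hn.ne_empty hk.1
  have := h k hk k hk1 le_rfl
  have e1 : layer X k k = extremePts X := by simp [layer, layerSub]
  have e2 : layerSub X k (k - 1) = peel X := by
    rw [layerSub, show k - (k - 1) = 1 by omega]; rfl
  rw [e1, e2] at this
  exact this

lemma nacs_peel {X : Set Pt} (h : IsNACS X) (hp : (peel X).Nonempty) : IsNACS (peel X) := by
  obtain ⟨hf, hn, hg, h⟩ := h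
  refine ⟨hf.subset sdiff_subset, hp, fun a ha b hb c hc => hg a ha.1 b hb.1 c hc.1, ?_⟩
  intro k hk j hj1 hjk
  have hk' : HasLayers X (k + 1) := by
    refine ⟨hk.1, fun i hi => ?_⟩
    rcases i with _ | i
    · exact hn.ne_empty
    · exact hk.2 i (by omega)
  have := h (k + 1) hk' j hj1 (by omega)
  have e : ∀ i ≤ k, layerSub X (k + 1) i = layerSub (peel X) k i := by
    intro i hi
    rw [layerSub, layerSub, show k + 1 - i = (k - i) + 1 by omega]; rfl
  rw [layer, e j hjk, e (j - 1) (by omega)] at this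
  exact this

lemma tri_of_interior {a b c z : Pt} (h : 0 < orient a b c)
    (hz : z ∈ interior (convexHull ℝ ({a, b, c} : Set Pt))) (h1 : orient a b z ≠ 0)
    (h2 : orient b c z ≠ 0) (h3 : orient c a z ≠ 0) : InTri a b c z := by
  have hz := interior_subset hz
  refine ⟨lt_of_le_of_ne (nonneg_of_mem_hull h hz) h1.symm, ?_, ?_⟩
  · refine lt_of_le_of_ne (nonneg_of_mem_hull (c := a) (by rwa [← ori_rot]) ?_) h2.symm
    convert hz using 2; ext; simp; tauto
  · refine lt_of_le_of_ne (nonneg_of_mem_hull (c := b) (by rwa [ori_rot]) ?_) h3.symm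
    convert hz using 2; ext; simp; tauto

lemma ne_of_orient {a b c : Pt} (h : orient a b c ≠ 0) : a ≠ b ∧ a ≠ c ∧ b ≠ c := by
  refine ⟨?_, ?_, ?_⟩ <;> rintro rfl
  · exact h (ori_aab _ _)
  · exact h (ori_aba _ _)
  · exact h (ori_abb _ _)

lemma nacs_cfg {X : Set Pt} (h : IsNACS X) {Z R : Finset Pt} (hZ : (Z : Set Pt) = peel X)
    (hR : (R : Set Pt) = extremePts X) : Cfg Z R := by
  have ht := nacs_top h
  obtain ⟨hf, -, hg, -⟩ := h
  have mZ : ∀ z, z ∈ Z ↔ z ∈ peel X := fun z => by rw [← hZ]; rfl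
  have mR : ∀ z, z ∈ R ↔ z ∈ extremePts X := fun z => by rw [← hR]; rfl
  have mX : ∀ z, (z ∈ Z ∨ z ∈ R) → z ∈ X := by
    rintro z (hz | hz)
    · exact ((mZ z).1 hz).1
    · exact ext_sub X ((mR z).1 hz)
  have hd : ∀ z ∈ Z, z ∉ R := fun z hz hzR => ((mZ z).1 hz).2 ((mR z).1 hzR)
  refine ⟨hd, ?_, ?_, ?_, ?_, ?_⟩
  · intro a b c ha hb hc
    exact hg a (mX a ha) b (mX b hb) c (mX c hc)
  · intro r hr
    obtain ⟨u, hu⟩ := ext_sep hf ((mR r).1 hr)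
    exact ⟨u, fun y hy => hu y (mX y hy)⟩
  · intro z hz
    rw [hR, hull_ext hf]
    exact subset_convexHull ℝ X ((mZ z).1 hz).1
  · intro a ha b hb c hc hp
    obtain ⟨hab, hac, hbc⟩ := ne_of_orient hp.ne'
    obtain ⟨z, ⟨hz, hzi⟩, -⟩ := ht a ((mR a).1 ha) b ((mR b).1 hb) c ((mR c).1 hc) hab hac hbc
    have hz' := (mZ z).2 hz
    have hne : ∀ r ∈ R, r ≠ z := by rintro r hr rfl; exact hd _ hz' hr
    have hr : ∀ r ∈ R, r ∈ X := fun r hr => mX r (Or.inr hr)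
    exact ⟨z, hz', tri_of_interior hp hzi
      (hg a (hr a ha) b (hr b hb) z hz.1 hab (hne a ha) (hne b hb))
      (hg b (hr b hb) c (hr c hc) z hz.1 hbc (hne b hb) (hne c hc))
      (hg c (hr c hc) a (hr a ha) z hz.1 hac.symm (hne c hc) (hne a ha))⟩
  · intro a ha b hb c hc z hz w hw h1 h2
    obtain ⟨hab, hac, hbc⟩ := ne_of_orient h1.pos.ne'
    exact (ht a ((mR a).1 ha) b ((mR b).1 hb) c ((mR c).1 hc) hab hac hbc).unique
      ⟨(mZ z).1 hz, h1.mem_interior⟩ ⟨(mZ w).1 hw, h2.mem_interior⟩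

lemma ext_of_peel_empty {X : Set Pt} (hp : peel X = ∅) : extremePts X = X :=
  (ext_sub X).antisymm (sdiff_eq_empty.1 hp)

lemma nacs_small {X : Set Pt} (h : IsNACS X) (hp : peel X = ∅) : X.ncard ≤ 2 := by
  by_contra hc
  obtain ⟨a, b, c, ha, hb, hc, h1, h2, h3⟩ := (Set.two_lt_ncard_iff h.1).1 (by omega)
  have e := ext_of_peel_empty hp
  obtain ⟨z, hz, -⟩ := nacs_top h a (by rwa [e]) b (by rwa [e]) c (by rwa [e]) h1 h2 h3
  rw [hp] at hz
  exact hz.1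

lemma nacs_parts {X : Set Pt} (h : IsNACS X) : X = peel X ∪ extremePts X := by
  rw [peel, sdiff_union_of_subset (ext_sub X)]

lemma nacs_card {X : Set Pt} (h : IsNACS X) (hp : (peel X).Nonempty) :
    (extremePts X).ncard = (peel X).ncard + 2 ∧ X.ncard = 2 * (peel X).ncard + 2 := by
  have fZ : (peel X).Finite := h.1.subset sdiff_subset
  have fR : (extremePts X).Finite := h.1.subset (ext_sub X)
  have hc := (nacs_cfg h (Z := fZ.toFinset) (R := fR.toFinset) (by simp) (by simp)).card_eq
    (by simpa using hp)
  rw [← Set.ncard_eq_toFinset_card _ fZ, ← Set.ncard_eq_toFinset_card _ fR] at hc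
  refine ⟨hc, ?_⟩
  have := Set.ncard_union_eq (s := peel X) (t := extremePts X) disjoint_sdiff_left fZ fR
  rw [← nacs_parts h] at this
  omega

lemma nacs_cfg2 {X : Set Pt} (h : IsNACS X) (h2 : 2 ≤ (peel X).ncard) :
    ∃ Z R E : Finset Pt, (Z : Set Pt) = peel X ∧ (R : Set Pt) = extremePts X ∧
      (E : Set Pt) = extremePts (peel X) ∧ Cfg2 Z R E := by
  have fZ : (peel X).Finite := h.1.subset sdiff_subset
  have fR : (extremePts X).Finite := h.1.subset (ext_sub X)
  have fE : (extremePts (peel X)).Finite := fZ.subset (ext_sub _)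
  have hp : (peel X).Nonempty := by
    apply Set.nonempty_of_ncard_ne_zero; omega
  have hZn := nacs_peel h hp
  have hcfg := nacs_cfg h (Z := fZ.toFinset) (R := fR.toFinset) (by simp) (by simp)
  refine ⟨fZ.toFinset, fR.toFinset, fE.toFinset, by simp, by simp, by simp, hcfg, ?_, ?_, ?_, ?_⟩
  · intro p
    simpa using mem_ext fZ p
  · intro p hp
    obtain ⟨u, hu⟩ := ext_sep fZ (by simpa using hp)
    exact ⟨u, fun z hz => hu z (by simpa using hz)⟩
  · rwa [← Set.ncard_eq_toFinset_card _ fZ]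
  · rw [← Set.ncard_eq_toFinset_card _ fE, ← Set.ncard_eq_toFinset_card _ fR]
    have h3 := (nacs_card h hp).1
    rcases (peel (peel X)).eq_empty_or_nonempty with he | hne
    · rw [ext_of_peel_empty he]
      have := nacs_small hZn he
      omega
    · have := nacs_card hZn hne
      omega

end

section

lemma cyc_three (c : Fin 3 → Pt) (h : 0 < orient (c 0) (c 2) (c 1)) (s t u : Fin 3)
    (h1 : s ≠ t) (h2 : s ≠ u) (h3 : t ≠ u) :
    0 < orient (c s) (c t) (c u) ↔ t = s + 2 := by
  have e1 := ori_rot (c 0) (c 2) (c 1)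
  have e2 := ori_rot (c 2) (c 1) (c 0)
  have e3 := ori_swap (c 0) (c 2) (c 1)
  have e4 := ori_rot (c 0) (c 1) (c 2)
  have e5 := ori_rot (c 1) (c 2) (c 0)
  fin_cases s <;> fin_cases t <;> fin_cases u <;>
    first
    | exact absurd rfl h1
    | exact absurd rfl h2
    | exact absurd rfl h3
    | exact iff_of_true (by dsimp; linarith) (by decide)
    | exact iff_of_false (by dsimp; linarith) (by decide)

lemma Tripled.sign_two {X Z E : Set Pt} {c : Fin 3 → Pt → Pt} (T : Tripled X Z E c) {p r : Pt}
    {s t u : Fin 3} (hr : r ∈ Z) (hs : s = 1 ∨ p ∈ E) (ht : t = 1 ∨ p ∈ E)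
    (hu : u = 1 ∨ r ∈ E) (hpr : p ≠ r) (hst : s ≠ t) :
    0 < orient (c s p) (c t p) (c u r) ↔ s < t := by
  have hp : p ∈ E := by
    rcases hs with rfl | hs
    · exact ht.resolve_left hst.symm
    · exact hs
  rcases lt_or_gt_of_ne hst with h | h
  · exact iff_of_true (T.near p hp r hr s t u hu hpr h) h
  · refine iff_of_false ?_ (not_lt.2 h.le)
    have := T.near p hp r hr t s u hu hpr h
    rw [ori_swap']; linarith

/-- The conclusion of the theorem, for short. -/
def SameType (X Y : Set Pt) : Prop :=
  ∃ f : Pt → Pt, Set.BijOn f X Y ∧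
      ∀ a ∈ X, ∀ b ∈ X, ∀ c ∈ X, a ≠ b → a ≠ c → b ≠ c →
        (0 < orient a b c ↔ 0 < orient (f a) (f b) (f c))

lemma sameType_tripled {X Z E X' Z' E' : Set Pt} {c c' : Fin 3 → Pt → Pt}
    (T : Tripled X Z E c) (T' : Tripled X' Z' E' c') {g : Pt → Pt} (hg : Set.BijOn g Z Z')
    (ho : ∀ a ∈ Z, ∀ b ∈ Z, ∀ c ∈ Z, a ≠ b → a ≠ c → b ≠ c →
        (0 < orient a b c ↔ 0 < orient (g a) (g b) (g c)))
    (hE : ∀ p ∈ Z, (p ∈ E ↔ g p ∈ E')) : SameType X X' := by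
  have hsurj := T.surj
  choose! P hP S hS he using hsurj
  have hS' : ∀ x ∈ X, S x = 1 ∨ g (P x) ∈ E' := fun x hx =>
    (hS x hx).imp id (hE _ (hP x hx)).1
  have hPg : ∀ x ∈ X, g (P x) ∈ Z' := fun x hx => hg.mapsTo (hP x hx)
  have hinj : ∀ x ∈ X, ∀ y ∈ X, P x = P y → S x = S y → x = y := by
    intro x hx y hy h1 h2
    rw [← he x hx, ← he y hy, h1, h2]
  refine ⟨fun x => c' (S x) (g (P x)), ⟨?_, ?_, ?_⟩, ?_⟩
  · intro x hx
    exact T'.mem _ (hPg x hx) _ (hS' x hx)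
  · intro x hx y hy hxy
    obtain ⟨h1, h2⟩ := T'.inj _ (hPg x hx) _ (hPg y hy) _ _ (hS' x hx) (hS' y hy) hxy
    exact hinj x hx y hy (hg.injOn (hP x hx) (hP y hy) h1) h2
  · intro y hy
    obtain ⟨q, hq, s, hs, rfl⟩ := T'.surj y hy
    obtain ⟨p, hp, rfl⟩ := hg.surjOn hq
    have hs' : s = 1 ∨ p ∈ E := hs.imp id (hE p hp).2
    have hx := T.mem p hp s hs'
    obtain ⟨h1, h2⟩ := T.inj _ (hP _ hx) p hp _ s (hS _ hx) hs' (he _ hx)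
    exact ⟨c s p, hx, by simp only [h1, h2]⟩
  · have key : ∀ x ∈ X, ∀ y ∈ X, ∀ w ∈ X, x ≠ y → P x = P y → P x ≠ P w →
        (0 < orient x y w ↔
          0 < orient (c' (S x) (g (P x))) (c' (S y) (g (P y))) (c' (S w) (g (P w)))) := by
      intro x hx y hy w hw hxy hp hpw
      have hst : S x ≠ S y := fun h => hxy (hinj x hx y hy hp h)
      conv_lhs => rw [← he x hx, ← he y hy, ← he w hw]
      have a1 := hS x hx
      have a2 := hS' x hx
      rw [hp] at hpw a1 a2 ⊢
      rw [T.sign_two (hP w hw) a1 (hS y hy) (hS w hw) hpw hst,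
        T'.sign_two (hPg w hw) a2 (hS' y hy) (hS' w hw)
          (fun h => hpw (hg.injOn (hP y hy) (hP w hw) h)) hst]
    intro x hx y hy w hw hxy hxw hyw
    by_cases h1 : P x = P y
    · by_cases h2 : P x = P w
      · have s1 : S x ≠ S y := fun h => hxy (hinj x hx y hy h1 h)
        have s2 : S x ≠ S w := fun h => hxw (hinj x hx w hw h2 h)
        have s3 : S y ≠ S w := fun h => hyw (hinj y hy w hw (h1.symm.trans h2) h)
        have hp : P x ∈ E := by
          rcases hS x hx with h | h
          · rw [h1]
            exact (hS y hy).resolve_left fun h' => s1 (h.trans h'.symm)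
          · exact h
        conv_lhs => rw [← he x hx, ← he y hy, ← he w hw]
        simp only
        rw [← h1, ← h2]
        rw [cyc_three (fun s => c s (P x)) (T.self _ hp) _ _ _ s1 s2 s3,
          cyc_three (fun s => c' s (g (P x))) (T'.self _ ((hE _ (hP x hx)).1 hp)) _ _ _ s1 s2 s3]
      · exact key x hx y hy w hw hxy h1 h2
    · by_cases h2 : P x = P w
      · have := key w hw x hx y hy hxw.symm h2.symm (fun h => h1 (h2.trans h))
        rwa [ori_rot, ori_rot (c' _ _)] at this
      · by_cases h3 : P y = P w
        · have := key y hy w hw x hx hyw h3 (fun h => h1 h.symm)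
          rwa [← ori_rot, ← ori_rot (c' _ _)] at this
        · conv_lhs => rw [← he x hx, ← he y hy, ← he w hw]
          simp only
          have gi : ∀ x ∈ X, ∀ y ∈ X, P x ≠ P y → g (P x) ≠ g (P y) :=
            fun x hx y hy h h' => h (hg.injOn (hP x hx) (hP y hy) h')
          rw [T.far _ (hP x hx) _ (hP y hy) _ (hP w hw) _ _ _ (hS x hx) (hS y hy) (hS w hw) h1 h2 h3,
            T'.far _ (hPg x hx) _ (hPg y hy) _ (hPg w hw) _ _ _ (hS' x hx) (hS' y hy) (hS' w hw)
              (gi x hx y hy h1) (gi x hx w hw h2) (gi y hy w hw h3)]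
          exact ho _ (hP x hx) _ (hP y hy) _ (hP w hw) h1 h2 h3

lemma ext_transfer {Z R E Z' R' E' : Finset Pt} (h : Cfg2 Z R E) (h' : Cfg2 Z' R' E')
    {g : Pt → Pt} (hg : Set.BijOn g (Z : Set Pt) (Z' : Set Pt))
    (ho : ∀ a ∈ Z, ∀ b ∈ Z, ∀ c ∈ Z, a ≠ b → a ≠ c → b ≠ c →
        (0 < orient a b c ↔ 0 < orient (g a) (g b) (g c))) (p : Pt) (hp : p ∈ Z) :
    p ∈ E ↔ g p ∈ E' := by
  constructor
  · intro hpE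
    obtain ⟨s, h1, h2, h3, h4⟩ := (h.exists_edges hpE).1
    refine h'.edge_left (p' := g s) ⟨hg.mapsTo hp, hg.mapsTo h2, fun e => h3 (hg.injOn h1 h2 e), ?_⟩
    intro z hz hz1 hz2
    obtain ⟨z, hz', rfl⟩ := hg.surjOn hz
    have n1 : z ≠ p := fun e => hz1 (by rw [e])
    have n2 : z ≠ s := fun e => hz2 (by rw [e])
    exact (ho p h1 s h2 z hz' h3 n1.symm n2.symm).1 (h4 z hz' n1 n2)
  · intro hpE
    obtain ⟨s, h1, h2, h3, h4⟩ := (h'.exists_edges hpE).1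
    obtain ⟨s, hs, rfl⟩ := hg.surjOn h2
    have h5 : p ≠ s := fun e => h3 (by rw [e])
    refine h.edge_left (p' := s) ⟨hp, hs, h5, ?_⟩
    intro z hz hz1 hz2
    exact (ho p hp s hs z hz h5 hz1.symm hz2.symm).2 (h4 (g z) (hg.mapsTo hz)
      (fun e => hz1 (hg.injOn hz hp e)) (fun e => hz2 (hg.injOn hz hs e)))

lemma sign_four (q : Fin 4 → Pt) (h : InTri (q 0) (q 1) (q 2) (q 3)) (i j k : Fin 4)
    (h1 : i ≠ j) (h2 : i ≠ k) (h3 : j ≠ k) :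
    0 < orient (q i) (q j) (q k) ↔ (i, j, k) ∈ ([(0,1,2),(1,2,0),(2,0,1),(0,1,3),(1,3,0),(3,0,1),
      (1,2,3),(2,3,1),(3,1,2),(2,0,3),(0,3,2),(3,2,0)] : List (Fin 4 × Fin 4 × Fin 4)) := by
  have a1 := h.pos
  obtain ⟨a2, a3, a4⟩ := h
  have b1 : ∀ a b c : Pt, 0 < orient a b c → 0 < orient b c a := fun a b c h => by rwa [← ori_rot]
  have b2 : ∀ a b c : Pt, 0 < orient a b c → 0 < orient c a b := fun a b c h => by rwa [ori_rot]
  have c0 : ∀ a b c : Pt, 0 < orient a b c → ¬ 0 < orient a c b := fun a b c h => by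
    rw [ori_swap]; linarith
  have c1 : ∀ a b c : Pt, 0 < orient a b c → ¬ 0 < orient c b a := fun a b c h => by
    rw [← ori_rot]; exact c0 _ _ _ h
  have c2 : ∀ a b c : Pt, 0 < orient a b c → ¬ 0 < orient b a c := fun a b c h => by
    rw [ori_swap']; linarith
  fin_cases i <;> fin_cases j <;>
    first
    | exact absurd rfl h1
    | (fin_cases k <;>
      first
      | exact absurd rfl h2
      | exact absurd rfl h3
      | (refine iff_of_true ?_ (by decide)
         first
         | exact a1 | exact b1 _ _ _ a1 | exact b2 _ _ _ a1
         | exact a2 | exact b1 _ _ _ a2 | exact b2 _ _ _ a2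
         | exact a3 | exact b1 _ _ _ a3 | exact b2 _ _ _ a3
         | exact a4 | exact b1 _ _ _ a4 | exact b2 _ _ _ a4)
      | (refine iff_of_false ?_ (by decide)
         first
         | exact c0 _ _ _ a1 | exact c1 _ _ _ a1 | exact c2 _ _ _ a1
         | exact c0 _ _ _ a2 | exact c1 _ _ _ a2 | exact c2 _ _ _ a2
         | exact c0 _ _ _ a3 | exact c1 _ _ _ a3 | exact c2 _ _ _ a3
         | exact c0 _ _ _ a4 | exact c1 _ _ _ a4 | exact c2 _ _ _ a4))

lemma nacs_four {X : Set Pt} (h : IsNACS X) (h1 : (peel X).ncard = 1) :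
    ∃ q : Fin 4 → Pt, Function.Injective q ∧ Set.range q = X ∧
      InTri (q 0) (q 1) (q 2) (q 3) := by
  obtain ⟨z, hz⟩ := Set.ncard_eq_one.1 h1
  have hn : (peel X).Nonempty := by rw [hz]; exact singleton_nonempty z
  obtain ⟨hc1, hc2⟩ := nacs_card h hn
  have fZ : (peel X).Finite := h.1.subset sdiff_subset
  have fR : (extremePts X).Finite := h.1.subset (ext_sub X)
  have hcfg := nacs_cfg h (Z := fZ.toFinset) (R := fR.toFinset) (by simp) (by simp)
  have main : ∀ a ∈ extremePts X, ∀ b ∈ extremePts X, ∀ c ∈ extremePts X, 0 < orient a b c →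
    ∃ q : Fin 4 → Pt, Function.Injective q ∧ Set.range q = X ∧
      InTri (q 0) (q 1) (q 2) (q 3) := by
    intro a ha b hb c hc hp
    obtain ⟨w, hw, ht⟩ := hcfg.ex a (by simpa using ha) b (by simpa using hb) c (by simpa using hc) hp
    have hw' : w ∈ peel X := by simpa using hw
    obtain ⟨n1, n2, n3⟩ := ne_of_orient hp.ne'
    have n4 := (ne_of_orient ht.1.ne')
    have n5 := (ne_of_orient ht.2.1.ne')
    have hinj : Function.Injective ![a, b, c, w] := by
      intro i j hij
      fin_cases i <;> fin_cases j <;> first | rfl | (exfalso; simp at hij; grind)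
    refine ⟨![a, b, c, w], hinj, ?_, ht⟩
    refine Set.eq_of_subset_of_ncard_le ?_ ?_ h.1
    · rintro x ⟨i, rfl⟩
      fin_cases i
      · exact ext_sub X ha
      · exact ext_sub X hb
      · exact ext_sub X hc
      · exact hw'.1
    · rw [← Set.image_univ, Set.ncard_image_of_injective _ hinj, Set.ncard_univ]
      simp; omega
  obtain ⟨a, b, c, ha, hb, hc, m1, m2, m3⟩ := (Set.two_lt_ncard_iff fR).1 (by omega)
  have hne := h.2.2.1 a (ext_sub X ha) b (ext_sub X hb) c (ext_sub X hc) m1 m2 m3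
  by_cases hp : 0 < orient a b c
  · exact main a ha b hb c hc hp
  · exact main a ha c hc b hb (ori_pos_swap hne hp)

lemma sameType_four {X Y : Set Pt} (hX : IsNACS X) (hY : IsNACS Y) (h1 : (peel X).ncard = 1)
    (h2 : (peel Y).ncard = 1) : SameType X Y := by
  obtain ⟨q, qi, rfl, qt⟩ := nacs_four hX h1
  obtain ⟨q', qi', rfl, qt'⟩ := nacs_four hY h2
  have hl : ∀ i, q' (Function.invFun q (q i)) = q' i := fun i => by
    rw [Function.leftInverse_invFun qi i]
  refine ⟨fun x => q' (Function.invFun q x), ⟨?_, ?_, ?_⟩, ?_⟩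
  · rintro x ⟨i, rfl⟩
    exact ⟨_, rfl⟩
  · rintro x ⟨i, rfl⟩ y ⟨j, rfl⟩ hxy
    simp only [hl] at hxy
    rw [qi' hxy]
  · rintro x ⟨i, rfl⟩
    exact ⟨q i, ⟨i, rfl⟩, hl i⟩
  · rintro x ⟨i, rfl⟩ y ⟨j, rfl⟩ w ⟨k, rfl⟩ n1 n2 n3
    simp only [hl]
    have m1 : i ≠ j := fun e => n1 (by rw [e])
    have m2 : i ≠ k := fun e => n2 (by rw [e])
    have m3 : j ≠ k := fun e => n3 (by rw [e])
    rw [sign_four q qt i j k m1 m2 m3, sign_four q' qt' i j k m1 m2 m3]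

lemma sameType_small {X Y : Set Pt} (hX : IsNACS X) (hY : IsNACS Y) (hc : X.ncard = Y.ncard)
    (h2 : X.ncard ≤ 2) : SameType X Y := by
  have : X.encard = Y.encard := by
    rw [← hX.1.cast_ncard_eq, ← hY.1.cast_ncard_eq, hc]
  obtain ⟨f, hf⟩ := hX.1.exists_bijOn_of_encard_eq this
  refine ⟨f, hf, fun a ha b hb c hc n1 n2 n3 => ?_⟩
  have := (Set.two_lt_ncard_iff hX.1).2 ⟨a, b, c, ha, hb, hc, n1, n2, n3⟩
  omega

lemma sameType_all (n : ℕ) : ∀ X Y : Set Pt, IsNACS X → IsNACS Y → X.ncard = Y.ncard →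
    X.ncard ≤ n → SameType X Y := by
  induction n with
  | zero =>
    intro X Y hX hY hc hn
    exact sameType_small hX hY hc (by omega)
  | succ n ih =>
    intro X Y hX hY hc hn
    by_cases h2 : X.ncard ≤ 2
    · exact sameType_small hX hY hc h2
    have nX : (peel X).Nonempty := by
      by_contra hne
      exact h2 (nacs_small hX (not_nonempty_iff_eq_empty.1 hne))
    have nY : (peel Y).Nonempty := by
      by_contra hne
      exact h2 (hc ▸ nacs_small hY (not_nonempty_iff_eq_empty.1 hne))
    have cX := (nacs_card hX nX).2
    have cY := (nacs_card hY nY).2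
    have hpos : 0 < (peel X).ncard := (Set.ncard_pos (hX.1.subset sdiff_subset)).2 nX
    by_cases h1 : (peel X).ncard = 1
    · exact sameType_four hX hY h1 (by omega)
    obtain ⟨g, hg, ho⟩ := ih (peel X) (peel Y) (nacs_peel hX nX) (nacs_peel hY nY)
      (by omega) (by omega)
    obtain ⟨Z, R, E, hZ, hR, hE, hcfg⟩ := nacs_cfg2 hX (by omega)
    obtain ⟨Z', R', E', hZ', hR', hE', hcfg'⟩ := nacs_cfg2 hY (by omega)
    obtain ⟨c, T⟩ := hcfg.tripled
    obtain ⟨c', T'⟩ := hcfg'.tripled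
    rw [← hZ, ← hZ'] at hg
    rw [← hZ] at ho
    have := sameType_tripled T T' hg ho (fun p hp => ext_transfer hcfg hcfg' hg ho p hp)
    rw [hZ, hR, hZ', hR', ← nacs_parts hX, ← nacs_parts hY] at this
    exact this

end
/-- Any two nested almost convex sets of the same cardinality have the same
order type. -/
theorem nacs_unique_order_type (X Y : Set Pt) (hX : IsNACS X) (hY : IsNACS Y)
    (hcard : X.ncard = Y.ncard) :
    ∃ f : Pt → Pt, Set.BijOn f X Y ∧
      ∀ a ∈ X, ∀ b ∈ X, ∀ c ∈ X, a ≠ b → a ≠ c → b ≠ c →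
        (0 < orient a b c ↔ 0 < orient (f a) (f b) (f c)) := by
  exact sameType_all X.ncard X Y hX hY hcard le_rfl
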